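/- Let n ≥ 2 be an integer, let h be an integer with 0 ≤ h ≤ n/2, let I ⊂ ℝ be a compact interval with 0 ∉ I, and let λ be a real number with 1/n ≤ λ ≤ 2/n. Then for every integer k with 0 ≤ k ≤ min{h, (n−1)/2}, the Hausdorff dimension of S_n^h(I,λ) is at most (n−k+1)(1−kλ)/((n−2k)(1+λ)). -/

import Mathlib

open MeasureTheory
open scoped ENNReal

/-- The rank (over `ℚ`) of the `(h+1) × (n−h+1)` matrix whose `(i,j)` entry is
`q_{i+j}` (for `0 ≤ i ≤ h`, `0 ≤ j ≤ n−h`; the index `i+j` is reduced mod `n+1`,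
which has no effect when `h ≤ n`). -/
noncomputable def hankelRank (n h : ℕ) (q : Fin (n + 1) → ℤ) : ℕ :=
  (Matrix.of fun (i : Fin (h + 1)) (j : Fin (n - h + 1)) =>
    ((q ⟨(i.1 + j.1) % (n + 1), Nat.mod_lt _ n.succ_pos⟩ : ℤ) : ℚ)).rank

/-- A vector `q ∈ ℤ^{n+1}` is of type `h` if `h` is the largest integer in `[0, n/2]`
such that the matrix `M_{h,n}(q)` has full rank `h + 1`. -/
def IsTypeVec (n h : ℕ) (q : Fin (n + 1) → ℤ) : Prop :=
  2 * h ≤ n ∧ hankelRank n h q = h + 1 ∧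
    ∀ h', h < h' → 2 * h' ≤ n → hankelRank n h' q ≠ h' + 1

/-- `S_n^h(I, λ)`: the set of `x ∈ I` such that `max_{1 ≤ i ≤ n} |q₀x^i − q_i| ≤ q₀^{−λ}`
holds for infinitely many `q ∈ ℤ^{n+1}` of type `h` with `q₀ ≥ 1`. -/
def TypeSimSet (n h : ℕ) (I : Set ℝ) (lam : ℝ) : Set ℝ :=
  {x ∈ I | {q : Fin (n + 1) → ℤ | 1 ≤ q 0 ∧ IsTypeVec n h q ∧
    ∀ i : Fin (n + 1), 1 ≤ i.1 →
      |(q 0 : ℝ) * x ^ (i.1) - (q i : ℝ)| ≤ (q 0 : ℝ) ^ (-lam)}.Infinite}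


namespace Bern

open Metric Module in
theorem pack {ι E : Type*} [NormedAddCommGroup E] [NormedSpace ℝ E] [FiniteDimensional ℝ E]
    (X : Finset ι) (φ : ι → E) (H h : ℝ) (hh : 0 < h) (H0 : 0 ≤ H)
    (hb : ∀ i ∈ X, ‖φ i‖ ≤ H) (hs : ∀ i ∈ X, ∀ j ∈ X, i ≠ j → h ≤ ‖φ i - φ j‖) :
    (X.card : ℝ) ≤ (1 + 2 * H / h) ^ finrank ℝ E := by
  borelize E
  let μ : Measure E := Measure.addHaar
  let δ : ℝ := h / 2
  let ρ : ℝ := H + h / 2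
  have δpos : 0 < δ := by positivity
  have ρpos : 0 < ρ := by positivity
  set A := ⋃ c ∈ X, ball (φ c : E) δ with hA
  have D : Set.Pairwise (X : Set ι) (Function.onFun Disjoint fun c => ball (φ c : E) δ) := by
    rintro c hc d hd hcd
    apply ball_disjoint_ball
    rw [dist_eq_norm]
    have := hs c hc d hd hcd
    simp only [δ]; linarith
  have A_subset : A ⊆ ball (0 : E) ρ := by
    refine Set.iUnion₂_subset fun x hx => ?_
    apply ball_subset_ball'
    rw [dist_zero_right]
    have := hb x hx
    simp only [δ, ρ]; linarith
  have I : (X.card : ℝ≥0∞) * ENNReal.ofReal (δ ^ finrank ℝ E) * μ (ball 0 1) ≤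
      ENNReal.ofReal (ρ ^ finrank ℝ E) * μ (ball 0 1) :=
    calc
      (X.card : ℝ≥0∞) * ENNReal.ofReal (δ ^ finrank ℝ E) * μ (ball 0 1) = μ A := by
        rw [hA, measure_biUnion_finset D fun c _ => measurableSet_ball]
        simp only [μ.addHaar_ball_of_pos _ δpos]
        simp only [Finset.sum_const, nsmul_eq_mul, mul_assoc]
      _ ≤ μ (ball (0 : E) ρ) := measure_mono A_subset
      _ = ENNReal.ofReal (ρ ^ finrank ℝ E) * μ (ball 0 1) := by
        simp only [μ.addHaar_ball_of_pos _ ρpos]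
  have J : (X.card : ℝ≥0∞) * ENNReal.ofReal (δ ^ finrank ℝ E) ≤ ENNReal.ofReal (ρ ^ finrank ℝ E) :=
    (ENNReal.mul_le_mul_iff_left (measure_ball_pos _ _ zero_lt_one).ne' measure_ball_lt_top.ne).1 I
  have K := ENNReal.toReal_le_of_le_ofReal (pow_nonneg ρpos.le _) J
  rw [ENNReal.toReal_mul, ENNReal.toReal_natCast, ENNReal.toReal_ofReal (by positivity)] at K
  have : (1 + 2 * H / h) ^ finrank ℝ E = ρ ^ finrank ℝ E / δ ^ finrank ℝ E := by
    rw [← div_pow]; congr 1; simp only [ρ, δ]; field_simp; ring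
  rw [this, le_div_iff₀ (by positivity)]
  exact K

/-- variant: `H ≥ c h` -/
theorem pack' {ι E : Type*} [NormedAddCommGroup E] [NormedSpace ℝ E] [FiniteDimensional ℝ E]
    (X : Finset ι) (φ : ι → E) (H h : ℝ) (n : ℕ) (hn : Module.finrank ℝ E ≤ n) (hh : 0 < h)
    (H0 : 0 ≤ H)
    (hb : ∀ i ∈ X, ‖φ i‖ ≤ H) (hs : ∀ i ∈ X, ∀ j ∈ X, i ≠ j → h ≤ ‖φ i - φ j‖) :
    (X.card : ℝ) ≤ (1 + 2 * H / h) ^ n := by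
  refine (pack X φ H h hh H0 hb hs).trans ?_
  apply pow_le_pow_right₀ _ hn
  have : 0 ≤ 2 * H / h := by positivity
  linarith

open Filter Topology in
/-- limsup covering lemma -/
theorem limsup_cover (A : Set ℝ) (t : ℝ) (ht : 0 ≤ t) (Cst : ℝ) (T : ℕ → Finset ℝ)
    (hT : ∀ i, ((T i).card : ℝ) ≤ Cst * (2:ℝ) ^ (i * t))
    (hA : ∀ x ∈ A, ∃ᶠ i in atTop, ∃ c ∈ T i, |x - c| ≤ (2:ℝ) ^ (-(i:ℝ))) :
    dimH A ≤ ENNReal.ofReal t := by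
  apply le_of_forall_gt_imp_ge_of_dense
  intro u hu
  rcases eq_or_ne u ⊤ with rfl | hu'
  · exact le_top
  lift u to NNReal using hu'
  have htu : t < u := by
    rwa [ENNReal.ofReal_lt_coe_iff ht] at hu
  have u0 : 0 < (u:ℝ) := ht.trans_lt htu
  apply dimH_le_of_hausdorffMeasure_ne_top
  have hC : 0 ≤ Cst := by
    have := hT 0
    simp at this
    exact (Nat.cast_nonneg _).trans this
  -- covers
  let ι : ℕ → Type := fun N => Σ i : ℕ, {c // c ∈ T (N + i)}
  let S : ∀ N, ι N → Set ℝ := fun N p => Metric.closedBall (p.2 : ℝ) ((2:ℝ) ^ (-((N + p.1 : ℕ):ℝ)))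
  have hdiam : ∀ N (p : ι N), Metric.ediam (S N p) ≤
      ENNReal.ofReal (2 * (2:ℝ) ^ (-((N + p.1 : ℕ):ℝ))) := by
    intro N p
    simp only [S, Real.closedBall_eq_Icc, Real.ediam_Icc]
    apply le_of_eq; congr 1; ring
  set q : ℝ := (2:ℝ) ^ (t - u) with hq
  have q0 : 0 < q := by positivity
  have q1 : q < 1 := Real.rpow_lt_one_of_one_lt_of_neg (by norm_num) (by linarith)
  have hsum : ∀ N, ∑' p : ι N, Metric.ediam (S N p) ^ (u:ℝ) ≤
      ENNReal.ofReal (Cst * 2 ^ (u:ℝ) * (1 - q)⁻¹) := by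
    intro N
    rw [ENNReal.tsum_sigma' (fun p : ι N => Metric.ediam (S N p) ^ (u:ℝ))]
    have key : ∀ i, ∑' c : {c // c ∈ T (N + i)}, Metric.ediam (S N ⟨i, c⟩) ^ (u:ℝ) ≤
        ENNReal.ofReal (Cst * 2 ^ (u:ℝ) * q ^ i) := by
      intro i
      calc ∑' c : {c // c ∈ T (N + i)}, Metric.ediam (S N ⟨i, c⟩) ^ (u:ℝ)
          ≤ ∑' c : {c // c ∈ T (N + i)},
              ENNReal.ofReal (2 * (2:ℝ) ^ (-((N + i : ℕ):ℝ))) ^ (u:ℝ) :=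
            ENNReal.tsum_le_tsum fun c => ENNReal.rpow_le_rpow (hdiam N ⟨i, c⟩) u0.le
        _ = (T (N + i)).card * ENNReal.ofReal ((2 * (2:ℝ) ^ (-((N + i : ℕ):ℝ))) ^ (u:ℝ)) := by
            rw [tsum_fintype, Finset.sum_const, ENNReal.ofReal_rpow_of_nonneg (by positivity) u0.le]
            simp
        _ = ENNReal.ofReal ((T (N + i)).card * (2 * (2:ℝ) ^ (-((N + i : ℕ):ℝ))) ^ (u:ℝ)) := by
            rw [ENNReal.ofReal_mul (by positivity), ENNReal.ofReal_natCast]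
        _ ≤ _ := by
            apply ENNReal.ofReal_le_ofReal
            have e1 : (2 * (2:ℝ) ^ (-((N + i : ℕ):ℝ))) ^ (u:ℝ) =
                2 ^ (u:ℝ) * 2 ^ (-((N + i : ℕ):ℝ) * u) := by
              rw [Real.mul_rpow (by norm_num) (by positivity), ← Real.rpow_mul (by norm_num)]
            have e2 : (2:ℝ) ^ ((N + i : ℕ) * t) * 2 ^ (-((N + i : ℕ):ℝ) * u) = q ^ (N + i) := by
              rw [hq, ← Real.rpow_natCast, ← Real.rpow_mul (by norm_num),
                ← Real.rpow_add (by norm_num)]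
              congr 1; ring
            rw [e1]
            calc ((T (N + i)).card : ℝ) * (2 ^ (u:ℝ) * 2 ^ (-((N + i : ℕ):ℝ) * u))
                ≤ (Cst * (2:ℝ) ^ ((N + i : ℕ) * t)) * (2 ^ (u:ℝ) * 2 ^ (-((N + i : ℕ):ℝ) * u)) := by
                  gcongr
                  exact hT _
              _ = Cst * 2 ^ (u:ℝ) * q ^ (N + i) := by rw [← e2]; ring
              _ ≤ _ := by
                  gcongr Cst * 2 ^ (u:ℝ) * ?_
                  exact pow_le_pow_of_le_one q0.le q1.le (by omega)
    calc _ ≤ ∑' i : ℕ, ENNReal.ofReal (Cst * 2 ^ (u:ℝ) * q ^ i) := ENNReal.tsum_le_tsum key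
      _ = ENNReal.ofReal (∑' i : ℕ, Cst * 2 ^ (u:ℝ) * q ^ i) := by
          rw [ENNReal.ofReal_tsum_of_nonneg]
          · intro i; positivity
          · exact (summable_geometric_of_lt_one q0.le q1).mul_left _
      _ = _ := by rw [tsum_mul_left, tsum_geometric_of_lt_one q0.le q1]
  have main := Measure.hausdorffMeasure_le_liminf_tsum (u:ℝ) A (l := atTop)
    (fun N : ℕ => ENNReal.ofReal (2 * (2:ℝ) ^ (-(N:ℝ)))) ?_ S ?_ ?_
  · refine ne_top_of_le_ne_top ?_ (main.trans (Filter.liminf_le_liminf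
      (v := fun _ => ENNReal.ofReal (Cst * 2 ^ (u:ℝ) * (1 - q)⁻¹)) (Eventually.of_forall hsum)))
    simp
  · have : Tendsto (fun N : ℕ => 2 * (2:ℝ) ^ (-(N:ℝ))) atTop (𝓝 0) := by
      have h := (tendsto_pow_atTop_nhds_zero_of_lt_one (r := (1/2:ℝ)) (by norm_num) (by norm_num)).const_mul 2
      rw [mul_zero] at h
      refine h.congr fun N => ?_
      rw [Real.rpow_neg (by norm_num), Real.rpow_natCast]; simp
    simpa using ENNReal.tendsto_ofReal this
  · refine Eventually.of_forall fun N p => (hdiam N p).trans (ENNReal.ofReal_le_ofReal ?_)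
    gcongr
    · norm_num
    · omega
  · refine Eventually.of_forall fun N x hx => ?_
    obtain ⟨i, hi, c, hc, hxc⟩ := (frequently_atTop.1 (hA x hx)) N
    obtain ⟨j, rfl⟩ := Nat.exists_eq_add_of_le hi
    refine Set.mem_iUnion.2 ⟨⟨j, c, hc⟩, ?_⟩
    simpa [S, Real.dist_eq] using hxc

end Bern


namespace Bern
open Polynomial

/-- complexification -/
noncomputable def cc (F : ℤ[X]) : ℂ[X] := F.map (Int.castRingHom ℂ)

/-- Mahler measure of `F (y + ρ X)` -/
noncomputable def mm (y ρ : ℝ) (F : ℤ[X]) : ℝ :=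
  ((cc F).comp (C (ρ : ℂ) * X + C (y : ℂ))).mahlerMeasure

/-- Taylor coefficients at `y` -/
noncomputable def tc (y : ℝ) (F : ℤ[X]) (j : ℕ) : ℝ :=
  (taylor y (F.map (Int.castRingHom ℝ))).coeff j

lemma cc_ne {F : ℤ[X]} (hF : F ≠ 0) : cc F ≠ 0 := by
  unfold cc
  exact (Polynomial.map_ne_zero_iff (RingHom.injective_int _)).2 hF

lemma cc_natDegree (F : ℤ[X]) : (cc F).natDegree = F.natDegree :=
  natDegree_map_eq_of_injective (RingHom.injective_int _) F

lemma cc_lc (F : ℤ[X]) : (cc F).leadingCoeff = (F.leadingCoeff : ℂ) := by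
  unfold cc
  rw [leadingCoeff_map_of_injective (RingHom.injective_int _)]; simp

lemma exists_roots (F : ℤ[X]) : ∃ β : Fin F.natDegree → ℂ,
    cc F = C (F.leadingCoeff : ℂ) * ∏ i, (X - C (β i)) := by
  have hs := IsAlgClosed.splits (cc F)
  have hcard : (cc F).roots.card = F.natDegree := by
    rw [← hs.natDegree_eq_card_roots, cc_natDegree]
  have hl : (cc F).roots.toList.length = F.natDegree := by simp [hcard]
  refine ⟨fun i => (cc F).roots.toList.get (i.cast hl.symm), ?_⟩
  conv_lhs => rw [hs.eq_prod_roots, cc_lc]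
  congr 1
  rw [← List.prod_ofFn]
  have : List.ofFn (fun i : Fin F.natDegree => X - C ((cc F).roots.toList.get (i.cast hl.symm)))
      = (cc F).roots.toList.map (fun a => X - C a) := by
    apply List.ext_get
    · simp [hcard]
    · intro n h1 h2; simp
  rw [this, ← Multiset.prod_coe, ← Multiset.map_coe, Multiset.coe_toList]

lemma mm_eq {F : ℤ[X]} {β : Fin F.natDegree → ℂ}
    (hβ : cc F = C (F.leadingCoeff : ℂ) * ∏ i, (X - C (β i))) (y : ℝ) {ρ : ℝ} (hρ : 0 < ρ) :
    mm y ρ F = |(F.leadingCoeff : ℝ)| * ∏ i, max ρ ‖(y : ℂ) - β i‖ := by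
  unfold mm
  rw [hβ, mul_comp, C_comp, Polynomial.prod_comp, mahlerMeasure_mul, mahlerMeasure_const]
  congr 1
  · rw [← Complex.ofReal_intCast, Complex.norm_real, Real.norm_eq_abs]
  · have h := prod_mahlerMeasure_eq_mahlerMeasure_prod
      (Finset.univ.val.map fun i : Fin F.natDegree => (X - C (β i)).comp (C (ρ:ℂ) * X + C (y:ℂ)))
    rw [Multiset.map_map] at h
    refine Eq.trans h ?_
    change (∏ i, _) = ∏ i, _
    refine Finset.prod_congr rfl fun i _ => ?_
    have : (X - C (β i)).comp (C (ρ:ℂ) * X + C (y:ℂ)) = C (ρ:ℂ) * X + C ((y:ℂ) - β i) := by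
      rw [sub_comp, X_comp, C_comp, C_sub]; ring
    simp only [Function.comp]
    rw [this, mahlerMeasure_C_mul_X_add_C (by exact_mod_cast hρ.ne')]
    congr 1
    simp [abs_of_pos hρ]

lemma mm_mul (y ρ : ℝ) (F G : ℤ[X]) : mm y ρ (F * G) = mm y ρ F * mm y ρ G := by
  simp [mm, cc, Polynomial.map_mul, mul_comp, mahlerMeasure_mul]

lemma mm_one (y ρ : ℝ) : mm y ρ 1 = 1 := by simp [mm, cc]

lemma mm_C (y ρ : ℝ) (a : ℤ) : mm y ρ (C a) = |(a:ℝ)| := by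
  simp [mm, cc]
  rw [← C_eq_intCast, mahlerMeasure_const]; simp

lemma mm_nonneg (y ρ : ℝ) (F : ℤ[X]) : 0 ≤ mm y ρ F := mahlerMeasure_nonneg _

lemma abs_lc_ge {F : ℤ[X]} (hF : F ≠ 0) : 1 ≤ |(F.leadingCoeff : ℝ)| := by
  rw [← Int.cast_abs]
  exact_mod_cast Int.one_le_abs (leadingCoeff_ne_zero.2 hF)

lemma mm_pos (y : ℝ) {ρ : ℝ} (hρ : 0 < ρ) {F : ℤ[X]} (hF : F ≠ 0) : 0 < mm y ρ F := by
  obtain ⟨β, hβ⟩ := exists_roots F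
  rw [mm_eq hβ y hρ]
  have := abs_lc_ge hF
  have : 0 < ∏ i, max ρ ‖(y : ℂ) - β i‖ := Finset.prod_pos fun i _ => lt_max_of_lt_left hρ
  positivity

lemma one_le_mm (y : ℝ) {F : ℤ[X]} (hF : F ≠ 0) : 1 ≤ mm y 1 F := by
  obtain ⟨β, hβ⟩ := exists_roots F
  rw [mm_eq hβ y one_pos]
  have h1 := abs_lc_ge hF
  have h2 : 1 ≤ ∏ i, max 1 ‖(y : ℂ) - β i‖ := by
    have := Finset.prod_le_prod (s := Finset.univ) (f := fun _ : Fin F.natDegree => (1:ℝ))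
      (g := fun i => max 1 ‖(y : ℂ) - β i‖) (fun _ _ => zero_le_one) (fun i _ => le_max_left _ _)
    simpa using this
  nlinarith

lemma mm_compare (y z K : ℝ) (hK : |y - z| ≤ K) (F : ℤ[X]) :
    mm y 1 F ≤ (1 + K) ^ F.natDegree * mm z 1 F := by
  obtain ⟨β, hβ⟩ := exists_roots F
  rw [mm_eq hβ y one_pos, mm_eq hβ z one_pos]
  have hK0 : 0 ≤ K := (abs_nonneg _).trans hK
  have : ∏ i, max 1 ‖(y : ℂ) - β i‖ ≤ ∏ i : Fin F.natDegree, ((1 + K) * max 1 ‖(z : ℂ) - β i‖) := by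
    refine Finset.prod_le_prod (fun i _ => by positivity) fun i _ => ?_
    have h1 : ‖(y : ℂ) - β i‖ ≤ K + ‖(z:ℂ) - β i‖ := by
      have : (y : ℂ) - β i = ((y - z : ℝ) : ℂ) + ((z:ℂ) - β i) := by push_cast; ring
      rw [this]
      refine (norm_add_le _ _).trans ?_
      rw [Complex.norm_real, Real.norm_eq_abs]; linarith
    have h2 := le_max_left 1 ‖(z:ℂ) - β i‖
    have h3 := le_max_right 1 ‖(z:ℂ) - β i‖
    apply max_le <;> nlinarith
  rw [Finset.prod_mul_distrib] at this
  simp only [Finset.prod_const, Finset.card_univ, Fintype.card_fin] at this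
  calc _ ≤ |(F.leadingCoeff : ℝ)| * ((1 + K) ^ F.natDegree * ∏ i, max 1 ‖(z : ℂ) - β i‖) := by gcongr
    _ = _ := by ring

lemma tc_taylor_cc (y : ℝ) (F : ℤ[X]) (j : ℕ) : (taylor (y:ℂ) (cc F)).coeff j = (tc y F j : ℂ) := by
  have : cc F = (F.map (Int.castRingHom ℝ)).map Complex.ofRealHom := by
    rw [cc, Polynomial.map_map]; congr 1
  rw [this, tc]
  change (taylor (Complex.ofRealHom y) _).coeff j = _
  rw [← Polynomial.map_taylor, coeff_map]; rfl

lemma shift_coeff (y ρ : ℝ) (F : ℤ[X]) (j : ℕ) :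
    ((cc F).comp (C (ρ : ℂ) * X + C (y : ℂ))).coeff j = ((tc y F j * ρ ^ j : ℝ) : ℂ) := by
  have : (cc F).comp (C (ρ : ℂ) * X + C (y : ℂ)) = (taylor (y:ℂ) (cc F)).comp (C (ρ:ℂ) * X) := by
    rw [taylor_apply, comp_assoc]; simp
  rw [this, comp_C_mul_X_coeff, tc_taylor_cc]
  push_cast; ring

lemma shift_natDegree (y : ℝ) {ρ : ℝ} (F : ℤ[X]) :
    ((cc F).comp (C (ρ : ℂ) * X + C (y : ℂ))).natDegree ≤ F.natDegree := by
  refine (natDegree_comp_le).trans ?_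
  rw [cc_natDegree]
  have : (C (ρ : ℂ) * X + C (y : ℂ)).natDegree ≤ 1 := natDegree_linear_le
  nlinarith

lemma tc_le_choose (y : ℝ) {ρ : ℝ} (hρ : 0 < ρ) (F : ℤ[X]) (j : ℕ) :
    |tc y F j| * ρ ^ j ≤ (F.natDegree).choose j * mm y ρ F := by
  have h := norm_coeff_le_choose_mul_mahlerMeasure j ((cc F).comp (C (ρ : ℂ) * X + C (y : ℂ)))
  rw [shift_coeff, Complex.norm_real, Real.norm_eq_abs, abs_mul, abs_of_pos (pow_pos hρ j)] at h
  refine h.trans ?_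
  unfold mm
  have := mahlerMeasure_nonneg ((cc F).comp (C (ρ : ℂ) * X + C (y : ℂ)))
  gcongr
  exact shift_natDegree y F

lemma tc_le (y : ℝ) {ρ : ℝ} (hρ : 0 < ρ) (F : ℤ[X]) (j d : ℕ) (hd : F.natDegree ≤ d) :
    |tc y F j| * ρ ^ j ≤ 2 ^ d * mm y ρ F := by
  refine (tc_le_choose y hρ F j).trans ?_
  have := mm_nonneg y ρ F
  gcongr
  calc ((F.natDegree.choose j : ℕ) : ℝ) ≤ ((2 ^ F.natDegree : ℕ) : ℝ) := by
        exact_mod_cast Nat.choose_le_two_pow _ _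
    _ = 2 ^ F.natDegree := by push_cast; rfl
    _ ≤ _ := pow_le_pow_right₀ (by norm_num) hd

lemma tc_zero_le (y : ℝ) {ρ : ℝ} (hρ : 0 < ρ) (F : ℤ[X]) : |tc y F 0| ≤ mm y ρ F := by
  simpa using tc_le_choose y hρ F 0

lemma mm_le_sum (y : ℝ) {ρ : ℝ} (hρ : 0 < ρ) (F : ℤ[X]) (d : ℕ) (hd : F.natDegree ≤ d) :
    mm y ρ F ≤ ∑ j ∈ Finset.range (d + 1), |tc y F j| * ρ ^ j := by
  refine (mahlerMeasure_le_sum_norm_coeff _).trans ?_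
  rw [sum_over_range' _ (by simp) (d + 1) (by have := shift_natDegree y (ρ := ρ) F; omega)]
  refine Finset.sum_le_sum fun j _ => ?_
  rw [shift_coeff, Complex.norm_real, Real.norm_eq_abs, abs_mul, abs_of_pos (pow_pos hρ j)]

lemma tc_zero (y : ℝ) (F : ℤ[X]) : tc y F 0 = (F.map (Int.castRingHom ℝ)).eval y := by
  simp [tc]

lemma tc_sub (y : ℝ) (F G : ℤ[X]) (j : ℕ) : tc y (F - G) j = tc y F j - tc y G j := by
  simp [tc]

lemma tc_eq_zero (y : ℝ) (F : ℤ[X]) (j : ℕ) (h : F.natDegree < j) : tc y F j = 0 := by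
  unfold tc
  apply coeff_eq_zero_of_natDegree_lt
  rw [natDegree_taylor]
  exact (natDegree_map_le).trans_lt h

lemma eval_eq_tc (y : ℝ) (F : ℤ[X]) (d : ℕ) (hd : F.natDegree ≤ d) (z : ℂ) :
    (cc F).eval z = ∑ j ∈ Finset.range (d + 1), (tc y F j : ℂ) * (z - y) ^ j := by
  have h : (cc F).eval z = (taylor (y:ℂ) (cc F)).eval (z - y) := by
    rw [taylor_eval_sub]
  rw [h, eval_eq_sum_range' (n := d + 1) (by rw [natDegree_taylor, cc_natDegree]; omega)]
  simp_rw [tc_taylor_cc]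

lemma tc_shift (x y : ℝ) (F : ℤ[X]) (d : ℕ) (hd : F.natDegree ≤ d) (j : ℕ) :
    tc y F j = ∑ k ∈ Finset.range (d + 1), (k.choose j : ℝ) * tc x F k * (y - x) ^ (k - j) := by
  have : taylor y (F.map (Int.castRingHom ℝ)) =
      taylor (y - x) (taylor x (F.map (Int.castRingHom ℝ))) := by
    rw [taylor_taylor]; congr 1; ring
  rw [tc, this, taylor_coeff, hasseDeriv_apply, sum_over_range' _ (by simp) (d+1), eval_finsetSum]
  · refine Finset.sum_congr rfl fun k _ => ?_
    simp [tc]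
  · rw [natDegree_taylor]
    exact (natDegree_map_le).trans_lt (by omega)

lemma resultant_roots {f : ℕ} (β : Fin f → ℂ) (g : ℂ[X]) (d : ℕ) (hg : g.natDegree ≤ d) :
    resultant (∏ i, (X - C (β i))) g f d = ∏ i, g.eval (β i) := by
  have h := resultant_prod_left Finset.univ (fun i : Fin f => X - C (β i)) g d
    (by simp [leadingCoeff_X_sub_C]) hg
  have hdeg : (∏ i : Fin f, (X - C (β i))).natDegree = f := by
    rw [natDegree_finsetProd_X_sub_C_eq_card]; simp
  rw [hdeg] at h
  rw [h]
  refine Finset.prod_congr rfl fun i _ => ?_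
  have h2 := resultant_X_sub_C_pow_left (β i) g 1 d hg
  rw [natDegree_X_sub_C]
  rwa [pow_one, pow_one] at h2

/-- The basic resultant estimate. -/
lemma res_ge {F : ℤ[X]} (hF : Irreducible F) (hF0 : 0 < F.natDegree) {β : Fin F.natDegree → ℂ}
    (hβ : cc F = C (F.leadingCoeff : ℂ) * ∏ i, (X - C (β i))) (Y : ℤ[X]) (hY : ¬ F ∣ Y) (d : ℕ)
    (hd : Y.natDegree ≤ d) :
    1 ≤ |(F.leadingCoeff : ℝ)| ^ d * ∏ i, ‖(cc Y).eval (β i)‖ := by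
  have e1 : resultant (cc F) (cc Y) F.natDegree d =
      (F.leadingCoeff : ℂ) ^ d * ∏ i, (cc Y).eval (β i) := by
    rw [hβ, resultant_C_mul_left, resultant_roots β (cc Y) d (by rwa [cc_natDegree])]
  have e2 : resultant (cc F) (cc Y) F.natDegree d = ((resultant F Y F.natDegree d : ℤ) : ℂ) := by
    unfold cc; rw [resultant_map_map]; simp
  have hne : (F.leadingCoeff : ℂ) ^ d * ∏ i, (cc Y).eval (β i) ≠ 0 := by
    apply mul_ne_zero
    · apply pow_ne_zero
      exact_mod_cast leadingCoeff_ne_zero.2 hF.ne_zero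
    · rw [Finset.prod_ne_zero_iff]
      intro i _ h0
      have hFi : (cc F).eval (β i) = 0 := by
        rw [hβ]; simp [eval_prod, Finset.prod_eq_zero_iff, sub_eq_zero]

      apply hY
      have hprim : F.IsPrimitive := hF.isPrimitive hF0.ne'
      have hirr : Irreducible (F.map (Int.castRingHom ℚ)) :=
        (IsPrimitive.Int.irreducible_iff_irreducible_map_cast hprim).1 hF
      have hev : ∀ G : ℤ[X], (cc G).eval (β i) = aeval (β i) (G.map (Int.castRingHom ℚ)) := by
        intro G
        rw [cc, eval_map, aeval_def, eval₂_map]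
        congr 1
      by_cases hYp : Y = 0
      · simp [hYp]
      have hcop : F.map (Int.castRingHom ℚ) ∣ Y.map (Int.castRingHom ℚ) := by
        by_contra hnd
        have hc : IsCoprime (F.map (Int.castRingHom ℚ)) (Y.map (Int.castRingHom ℚ)) :=
          (hirr.coprime_iff_not_dvd).2 hnd
        obtain ⟨a, b, hab⟩ := hc
        have := congrArg (aeval (β i)) hab
        rw [map_add, map_mul, map_mul, ← hev, ← hev, hFi, h0] at this
        simp at this
      exact (IsPrimitive.Int.dvd_iff_map_cast_dvd_map_cast _ _ hprim).2 hcop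
  rw [← e1, e2] at hne
  have hne' : resultant F Y F.natDegree d ≠ 0 := by exact_mod_cast hne
  have h3 := congrArg norm (e2.symm.trans e1)
  rw [norm_mul, norm_pow, norm_prod] at h3
  rw [← Complex.ofReal_intCast F.leadingCoeff, Complex.norm_real, Real.norm_eq_abs] at h3
  rw [← h3, ← Complex.ofReal_intCast, Complex.norm_real, Real.norm_eq_abs, ← Int.cast_abs]
  exact_mod_cast Int.one_le_abs hne'

end Bern


namespace Bern
open Polynomial

/-- scaled Taylor coordinates -/
noncomputable def ph (y δ : ℝ) (d : ℕ) (F : ℤ[X]) : Fin (d + 1) → ℝ :=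
  fun j => tc y F j / δ ^ (2 - (j : ℕ))

lemma ph_sub (y δ : ℝ) (d : ℕ) (F G : ℤ[X]) : ph y δ d (F - G) = ph y δ d F - ph y δ d G := by
  ext j; simp [ph, tc_sub, sub_div]

lemma tc_le_ph (y : ℝ) {δ : ℝ} (hδ : 0 < δ) {d : ℕ} {F : ℤ[X]} (hd : F.natDegree ≤ d) (j : ℕ) :
    |tc y F j| ≤ ‖ph y δ d F‖ * δ ^ (2 - j) := by
  by_cases hj : j < d + 1
  · have h := norm_le_pi_norm (ph y δ d F) ⟨j, hj⟩
    simp only [ph, Real.norm_eq_abs, abs_div, abs_of_pos (pow_pos hδ _)] at h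
    rw [div_le_iff₀ (pow_pos hδ _)] at h
    exact h
  · rw [tc_eq_zero y F j (by omega)]
    simp; positivity

lemma ph_le {y : ℝ} {δ : ℝ} (hδ : 0 < δ) {d : ℕ} {F : ℤ[X]} {t : ℝ} (ht : 0 ≤ t)
    (h : ∀ j < d + 1, |tc y F j| ≤ t * δ ^ (2 - j)) : ‖ph y δ d F‖ ≤ t := by
  rw [pi_norm_le_iff_of_nonneg ht]
  intro j
  simp only [ph, Real.norm_eq_abs, abs_div, abs_of_pos (pow_pos hδ _)]
  rw [div_le_iff₀ (pow_pos hδ _)]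
  exact h j j.2

lemma mu_le_ph (y : ℝ) {δ : ℝ} (hδ : 0 < δ) (hδ1 : δ ≤ 1) {d : ℕ} {F : ℤ[X]}
    (hd : F.natDegree ≤ d) : mm y 1 F ≤ (d + 1) * ‖ph y δ d F‖ := by
  refine (mm_le_sum y one_pos F d hd).trans ?_
  calc _ ≤ ∑ j ∈ Finset.range (d + 1), ‖ph y δ d F‖ := by
        refine Finset.sum_le_sum fun j _ => ?_
        rw [one_pow, mul_one]
        refine (tc_le_ph y hδ hd j).trans ?_
        exact mul_le_of_le_one_right (norm_nonneg _) (pow_le_one₀ hδ.le hδ1)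
    _ = _ := by simp

lemma nu_le_ph (y : ℝ) {δ : ℝ} (hδ : 0 < δ) (hδ1 : δ ≤ 1) {d : ℕ} {F : ℤ[X]}
    (hd : F.natDegree ≤ d) : mm y δ F ≤ (d + 1) * (‖ph y δ d F‖ * δ ^ 2) := by
  refine (mm_le_sum y hδ F d hd).trans ?_
  calc _ ≤ ∑ j ∈ Finset.range (d + 1), ‖ph y δ d F‖ * δ ^ 2 := by
        refine Finset.sum_le_sum fun j _ => ?_
        calc |tc y F j| * δ ^ j ≤ ‖ph y δ d F‖ * δ ^ (2 - j) * δ ^ j := by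
              gcongr; exact tc_le_ph y hδ hd j
          _ = ‖ph y δ d F‖ * δ ^ (2 - j + j) := by rw [pow_add]; ring
          _ ≤ _ := by
              gcongr ‖ph y δ d F‖ * ?_
              exact pow_le_pow_of_le_one hδ.le hδ1 (by omega)
    _ = _ := by simp

lemma eval_le_ph (y : ℝ) {δ : ℝ} (hδ : 0 < δ) {d : ℕ} (hd2 : 2 ≤ d) {F : ℤ[X]}
    (hd : F.natDegree ≤ d) (z : ℂ) : ‖(cc F).eval z‖ ≤
      ((d + 1) * ‖ph y δ d F‖) * (max δ ‖(y:ℂ) - z‖ ^ 2 * max 1 ‖(y:ℂ) - z‖ ^ (d - 2)) := by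
  rw [eval_eq_tc y F d hd z]
  refine (norm_sum_le _ _).trans ?_
  have hm1 : 1 ≤ max 1 ‖(y:ℂ) - z‖ := le_max_left _ _
  calc _ ≤ ∑ j ∈ Finset.range (d + 1), ‖ph y δ d F‖ *
        (max δ ‖(y:ℂ) - z‖ ^ 2 * max 1 ‖(y:ℂ) - z‖ ^ (d - 2)) := by
        refine Finset.sum_le_sum fun j hj => ?_
        rw [norm_mul, norm_pow, Complex.norm_real, Real.norm_eq_abs, norm_sub_rev z]
        calc |tc y F j| * ‖(y:ℂ) - z‖ ^ j
            ≤ (‖ph y δ d F‖ * δ ^ (2 - j)) * ‖(y:ℂ) - z‖ ^ j := by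
              gcongr; exact tc_le_ph y hδ hd j
          _ = ‖ph y δ d F‖ * (δ ^ (2 - j) * ‖(y:ℂ) - z‖ ^ j) := by ring
          _ ≤ _ := by
            gcongr ‖ph y δ d F‖ * ?_
            rcases le_or_gt 2 j with h2 | h2
            · obtain ⟨i, rfl⟩ := Nat.exists_eq_add_of_le h2
              rw [Nat.sub_eq_zero_of_le h2, pow_zero, one_mul, pow_add]
              have hi : i ≤ d - 2 := by simp at hj; omega
              gcongr
              · exact le_max_right _ _
              · calc ‖(y:ℂ) - z‖ ^ i ≤ max 1 ‖(y:ℂ) - z‖ ^ i := by gcongr; exact le_max_right _ _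
                  _ ≤ _ := pow_le_pow_right₀ hm1 hi
            · calc δ ^ (2 - j) * ‖(y:ℂ) - z‖ ^ j
                  ≤ max δ ‖(y:ℂ) - z‖ ^ (2 - j) * max δ ‖(y:ℂ) - z‖ ^ j := by
                    gcongr
                    · exact le_max_left _ _
                    · exact le_max_right _ _
                _ = max δ ‖(y:ℂ) - z‖ ^ 2 := by rw [← pow_add]; congr 1; omega
                _ ≤ _ := le_mul_of_one_le_right (by positivity) (one_le_pow₀ hm1)
    _ = _ := by simp; ring

lemma prod_b (y : ℝ) {δ : ℝ} (hδ : 0 < δ) {d : ℕ} (hd2 : 2 ≤ d) {F : ℤ[X]}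
    {β : Fin F.natDegree → ℂ} (hβ : cc F = C (F.leadingCoeff : ℂ) * ∏ i, (X - C (β i))) :
    |(F.leadingCoeff : ℝ)| ^ d *
      ∏ i, (max δ ‖(y:ℂ) - β i‖ ^ 2 * max 1 ‖(y:ℂ) - β i‖ ^ (d - 2)) =
      mm y δ F ^ 2 * mm y 1 F ^ (d - 2) := by
  rw [mm_eq hβ y hδ, mm_eq hβ y one_pos, Finset.prod_mul_distrib, Finset.prod_pow, Finset.prod_pow,
    mul_pow, mul_pow]
  obtain ⟨e, rfl⟩ := Nat.exists_eq_add_of_le hd2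
  rw [Nat.add_sub_cancel_left, pow_add]; ring

/-- resultant upper/lower bound -/
lemma res_le (y : ℝ) {δ : ℝ} (hδ : 0 < δ) {d : ℕ} (hd2 : 2 ≤ d) {F : ℤ[X]}
    (hF : Irreducible F) (hF0 : 0 < F.natDegree) {Y : ℤ[X]} (hY : ¬ F ∣ Y) (hd : Y.natDegree ≤ d)
    {t : ℝ} (ht : ‖ph y δ d Y‖ ≤ t) :
    1 ≤ ((d + 1) * t) ^ F.natDegree * (mm y δ F ^ 2 * mm y 1 F ^ (d - 2)) := by
  obtain ⟨β, hβ⟩ := exists_roots F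
  refine (res_ge hF hF0 hβ Y hY d hd).trans ?_
  rw [← prod_b y hδ hd2 hβ]
  have ht0 : 0 ≤ t := (norm_nonneg _).trans ht
  calc |(F.leadingCoeff : ℝ)| ^ d * ∏ i, ‖(cc Y).eval (β i)‖
      ≤ |(F.leadingCoeff : ℝ)| ^ d * ∏ i, (((d + 1) * t) *
        (max δ ‖(y:ℂ) - β i‖ ^ 2 * max 1 ‖(y:ℂ) - β i‖ ^ (d - 2))) := by
        gcongr with i
        refine (eval_le_ph y hδ hd2 hd (β i)).trans ?_
        gcongr
    _ = _ := by
        rw [Finset.prod_mul_distrib]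
        simp only [Finset.prod_const, Finset.card_univ, Fintype.card_fin]
        ring

/-- number of classes modulo `F` -/
lemma classes (y : ℝ) {δ : ℝ} (hδ : 0 < δ) {d : ℕ} (hd2 : 2 ≤ d) {F : ℤ[X]}
    (hF : Irreducible F) (hF0 : 0 < F.natDegree) {H : ℝ} (X : Finset ℤ[X])
    (hX : ∀ P ∈ X, P.natDegree ≤ d ∧ ‖ph y δ d P‖ ≤ H)
    (hsep : ∀ P ∈ X, ∀ Q ∈ X, P ≠ Q → ¬ F ∣ P - Q) (hcard : 2 ≤ X.card) :
    (X.card : ℝ) ≤ (4 * (d + 1) * H) ^ F.natDegree * (mm y δ F ^ 2 * mm y 1 F ^ (d - 2)) := by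
  obtain ⟨β, hβ⟩ := exists_roots F
  set Z := mm y δ F ^ 2 * mm y 1 F ^ (d - 2) with hZ
  have hZ0 : 0 < Z := by
    have h1 := mm_pos y hδ hF.ne_zero
    have h2 := mm_pos y one_pos hF.ne_zero
    positivity
  set b : Fin F.natDegree → ℝ := fun i => max δ ‖(y:ℂ) - β i‖ ^ 2 * max 1 ‖(y:ℂ) - β i‖ ^ (d - 2) with hb
  have hb0 : ∀ i, 0 < b i := fun i => by
    have : 0 < max δ ‖(y:ℂ) - β i‖ := lt_max_of_lt_left hδ
    have : 0 < max 1 ‖(y:ℂ) - β i‖ := lt_max_of_lt_left one_pos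
    positivity
  obtain ⟨P0, hP0, P1, hP1, hne⟩ := Finset.one_lt_card.1 hcard
  have hH0 : 0 ≤ H := (norm_nonneg _).trans (hX P0 hP0).2
  -- the linear map
  let L : (Fin F.natDegree → ℝ) →ₗ[ℝ] (Fin F.natDegree → ℂ) :=
    { toFun := fun c i => ∑ j : Fin F.natDegree, (c j : ℂ) * (β i ^ (j : ℕ) / b i)
      map_add' := by
        intro c c'; ext i; simp [add_mul, Finset.sum_add_distrib]
      map_smul' := by
        intro r c; ext i; simp [Finset.mul_sum, mul_assoc] }
  let ψ : ℤ[X] → (Fin F.natDegree → ℂ) := fun P i => (cc P).eval (β i) / b i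
  have hFi : ∀ i, (cc F).eval (β i) = 0 := fun i => by
    rw [hβ]; simp [eval_prod, Finset.prod_eq_zero_iff, sub_eq_zero]
  have hcast : ∀ G : ℤ[X], cc G = (G.map (Int.castRingHom ℝ)).map Complex.ofRealHom := by
    intro G; rw [cc, Polynomial.map_map]; congr 1
  have hrange : ∀ P : ℤ[X], ψ P ∈ LinearMap.range L := by
    intro P
    set FR := F.map (Int.castRingHom ℝ) with hFR
    have hFRdeg : FR.natDegree = F.natDegree := natDegree_map_eq_of_injective (RingHom.injective_int _) F
    have hFR0 : FR ≠ 0 := (Polynomial.map_ne_zero_iff (RingHom.injective_int _)).2 hF.ne_zero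
    set r := (P.map (Int.castRingHom ℝ)) % FR with hr
    have hrdeg : r.natDegree < F.natDegree := by
      rw [← hFRdeg]; exact natDegree_mod_lt _ (by omega)
    refine ⟨fun j => r.coeff j, ?_⟩
    ext i
    have e1 : (cc P).eval (β i) = (r.map Complex.ofRealHom).eval (β i) := by
      have := congrArg (fun g => (g.map Complex.ofRealHom).eval (β i))
        (EuclideanDomain.mod_add_div (P.map (Int.castRingHom ℝ)) FR)
      simp only [Polynomial.map_add, Polynomial.map_mul, eval_add, eval_mul] at this
      rw [hcast P, ← this, hFR, ← hcast F, hFi i]; simp [hr, hFR]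
    simp only [ψ, L, LinearMap.coe_mk, AddHom.coe_mk, e1]
    rw [eval_map, eval₂_eq_sum_range' _ hrdeg, Finset.sum_div, Finset.sum_range]
    refine Finset.sum_congr rfl fun j _ => ?_
    simp [mul_div_assoc]
  -- separation
  set h : ℝ := Z ^ (-(1:ℝ) / F.natDegree) with hh
  have hh0 : 0 < h := Real.rpow_pos_of_pos hZ0 _
  have hf0 : (F.natDegree:ℝ) ≠ 0 := by exact_mod_cast hF0.ne'
  have hhf : h ^ F.natDegree = Z⁻¹ := by
    rw [hh, ← Real.rpow_natCast, ← Real.rpow_mul hZ0.le, div_mul_cancel₀ _ hf0, Real.rpow_neg_one]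
  have hsep' : ∀ P ∈ X, ∀ Q ∈ X, P ≠ Q → h ≤ ‖ψ P - ψ Q‖ := by
    intro P hP Q hQ hPQ
    by_contra hlt
    push Not at hlt
    have h1 := res_ge hF hF0 hβ (P - Q) (hsep P hP Q hQ hPQ) d
      ((natDegree_sub_le _ _).trans (max_le (hX P hP).1 (hX Q hQ).1))
    have h2 : ∏ i, ‖(cc (P - Q)).eval (β i)‖ < ∏ i, (h * b i) := by
      have key : ∀ i, ‖(cc (P - Q)).eval (β i)‖ < h * b i := by
        intro i
        have h3 := (norm_le_pi_norm (ψ P - ψ Q) i).trans_lt hlt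
        have h4 : (ψ P - ψ Q) i = (cc (P - Q)).eval (β i) / b i := by
          simp [ψ, cc, sub_div]
        rw [h4, norm_div, Complex.norm_real, Real.norm_eq_abs, abs_of_pos (hb0 i),
          div_lt_iff₀ (hb0 i)] at h3
        exact h3
      by_cases hz : ∃ i, ‖(cc (P - Q)).eval (β i)‖ = 0
      · obtain ⟨i, hi⟩ := hz
        rw [Finset.prod_eq_zero (Finset.mem_univ i) hi]
        exact Finset.prod_pos fun i _ => mul_pos hh0 (hb0 i)
      · push Not at hz
        refine Finset.prod_lt_prod (fun i _ => lt_of_le_of_ne (norm_nonneg _) (hz i).symm)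
          (fun i _ => (key i).le) ⟨⟨0, hF0⟩, Finset.mem_univ _, key _⟩
    rw [Finset.prod_mul_distrib] at h2
    simp only [Finset.prod_const, Finset.card_univ, Fintype.card_fin] at h2
    have h5 := prod_b y hδ hd2 hβ
    have hl : 0 < |(F.leadingCoeff : ℝ)| ^ d := by
      have := abs_lc_ge hF.ne_zero
      positivity
    have h6 := mul_lt_mul_of_pos_left h2 hl
    rw [hhf] at h6
    have h7 : |(F.leadingCoeff : ℝ)| ^ d * (Z⁻¹ * ∏ i, b i) = 1 := by
      rw [mul_left_comm, h5, ← hZ, inv_mul_cancel₀ hZ0.ne']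
    linarith
  have hbd : ∀ P ∈ X, ‖ψ P‖ ≤ (d + 1) * H := by
    intro P hP
    rw [pi_norm_le_iff_of_nonneg (by positivity)]
    intro i
    simp only [ψ]
    rw [norm_div, Complex.norm_real, Real.norm_eq_abs, abs_of_pos (hb0 i), div_le_iff₀ (hb0 i)]
    refine (eval_le_ph y hδ hd2 (hX P hP).1 (β i)).trans ?_
    have := (hX P hP).2
    have := (hb0 i).le
    gcongr
  have hp := pack' X (fun P => (⟨ψ P, hrange P⟩ : LinearMap.range L)) ((d + 1) * H) h F.natDegree
    (by simpa using LinearMap.finrank_range_le L) hh0 (by positivity)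
    (fun P hP => hbd P hP) (fun P hP Q hQ hPQ => hsep' P hP Q hQ hPQ)
  refine hp.trans ?_
  have hle : h ≤ 2 * ((d + 1) * H) := by
    have h1 := hsep' P0 hP0 P1 hP1 hne
    have h2 := norm_sub_le (ψ P0) (ψ P1)
    have h3 := hbd P0 hP0
    have h4 := hbd P1 hP1
    linarith
  calc (1 + 2 * ((d + 1) * H) / h) ^ F.natDegree ≤ ((4 * (d + 1) * H) / h) ^ F.natDegree := by
        have : 1 ≤ 2 * ((d + 1) * H) / h := by rwa [one_le_div hh0]
        have e : (4 * (d + 1) * H) / h = 2 * (2 * ((d + 1) * H) / h) := by ring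
        rw [e]
        gcongr
        linarith
    _ = _ := by rw [div_pow, hhf]; simp

/-- counting polynomials with bounded measure -/
lemma count_mm (y : ℝ) {d e : ℕ} (hed : e ≤ d) {B : ℝ} (hB : 1 ≤ B) (X : Finset ℤ[X])
    (hX : ∀ P ∈ X, P.natDegree ≤ e ∧ mm y 1 P ≤ B) :
    (X.card : ℝ) ≤ (3 * (d + 1) * 2 ^ d * B) ^ (e + 1) := by
  have hsep : ∀ P ∈ X, ∀ Q ∈ X, P ≠ Q → 1 / ((d:ℝ) + 1) ≤ ‖ph y 1 e P - ph y 1 e Q‖ := by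
    intro P hP Q hQ hPQ
    rw [← ph_sub]
    have h1 := one_le_mm y (sub_ne_zero.2 hPQ)
    have h2 := mu_le_ph y one_pos le_rfl (F := P - Q) (d := e)
      ((natDegree_sub_le _ _).trans (max_le (hX P hP).1 (hX Q hQ).1))
    rw [div_le_iff₀ (by positivity)]
    have h3 : ((e:ℝ) + 1) * ‖ph y 1 e (P - Q)‖ ≤ (d + 1) * ‖ph y 1 e (P - Q)‖ := by gcongr
    linarith
  have hbd : ∀ P ∈ X, ‖ph y 1 e P‖ ≤ 2 ^ d * B := by
    intro P hP
    refine ph_le one_pos (by positivity) fun j _ => ?_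
    have h1 := tc_le y one_pos P j d ((hX P hP).1.trans hed)
    have h2 := (hX P hP).2
    rw [one_pow, mul_one] at h1 ⊢
    exact h1.trans (by gcongr)
  refine (pack' X (ph y 1 e) (2 ^ d * B) (1 / ((d:ℝ) + 1)) (e + 1) (by simp) (by positivity)
    (by positivity) hbd hsep).trans ?_
  gcongr
  rw [div_div_eq_mul_div, div_one]
  have h1 : (1:ℝ) ≤ 2 ^ d := one_le_pow₀ (by norm_num)
  have h2 : (1:ℝ) ≤ (d + 1) := by linarith [(Nat.cast_nonneg d : (0:ℝ) ≤ d)]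
  have h3 : 1 ≤ 2 ^ d * B * (d + 1) :=
    one_le_mul_of_one_le_of_one_le (one_le_mul_of_one_le_of_one_le h1 hB) h2
  linarith

lemma finite_mm (y : ℝ) (d : ℕ) (B : ℝ) : {P : ℤ[X] | P.natDegree ≤ d ∧ mm y 1 P ≤ B}.Finite := by
  by_contra hinf
  set B' := max 1 B with hB'
  obtain ⟨N, hN⟩ := exists_nat_gt ((3 * (d + 1) * 2 ^ d * B') ^ (d + 1))
  obtain ⟨X, hX, hXc⟩ := Set.Infinite.exists_subset_card_eq hinf N
  have := count_mm y (le_refl d) (le_max_left 1 B) X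
    (fun P hP => ⟨(hX hP).1, (hX hP).2.trans (le_max_right _ _)⟩)
  rw [hXc] at this
  linarith

end Bern


namespace Bern
open Polynomial

lemma eq_of_dvd {F G : ℤ[X]} (hF : Irreducible F) (hG : Irreducible G) (hF0 : 0 < F.leadingCoeff)
    (hG0 : 0 < G.leadingCoeff) (h : F ∣ G) : F = G := by
  have ha : Associated F G := hF.associated_of_dvd hG h
  obtain ⟨u, hu⟩ := ha
  obtain ⟨r, hr, hru⟩ := Polynomial.isUnit_iff.1 u.isUnit
  rw [← hru] at hu
  rcases Int.isUnit_iff.1 hr with rfl | rfl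
  · simpa using hu
  · rw [← hu] at hG0
    simp at hG0
    omega

open UniqueFactorizationMonoid in
lemma exists_fact {R : ℤ[X]} (hR : R ≠ 0) : ∃ (𝔉 : Finset ℤ[X]) (e : ℤ[X] → ℕ) (c : ℤ), c ≠ 0 ∧
    R = C c * ∏ F ∈ 𝔉, F ^ e F ∧ (∀ F ∈ 𝔉, Irreducible F ∧ 0 < F.natDegree ∧ 1 ≤ e F) ∧
    ∀ F ∈ 𝔉, ∀ G ∈ 𝔉, F ≠ G → ¬ F ∣ G := by
  classical
  set s := normalizedFactors R with hs
  have hprod := prod_normalizedFactors hR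
  obtain ⟨u, hu⟩ := hprod
  rw [Finset.prod_multiset_count, ← Finset.prod_filter_mul_prod_filter_not _
    (fun F : ℤ[X] => 0 < F.natDegree)] at hu
  set Q := ∏ F ∈ s.toFinset.filter (fun F : ℤ[X] => ¬ 0 < F.natDegree), F ^ s.count F with hQ
  have hQ0 : Q.natDegree = 0 := by
    apply Nat.le_zero.1
    refine (natDegree_prod_le _ _).trans ?_
    apply le_of_eq
    refine Finset.sum_eq_zero fun F hF => ?_
    have := (Finset.mem_filter.1 hF).2
    apply Nat.le_zero.1
    refine natDegree_pow_le.trans ?_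
    have h0 : F.natDegree = 0 := by omega
    simp [h0]
  obtain ⟨a, ha⟩ := natDegree_eq_zero.1 hQ0
  obtain ⟨r, hr, hru⟩ := Polynomial.isUnit_iff.1 u.isUnit
  rw [← ha, ← hru] at hu
  refine ⟨s.toFinset.filter (fun F : ℤ[X] => 0 < F.natDegree), fun F => s.count F, a * r, ?_, ?_, ?_, ?_⟩
  · rintro h0
    apply hR
    rw [← hu, mul_assoc, ← C_mul, h0]; simp
  · rw [← hu, C_mul]; ring
  · intro F hF
    simp only [Finset.mem_filter, Multiset.mem_toFinset] at hF
    exact ⟨irreducible_of_normalized_factor F hF.1, hF.2, Multiset.one_le_count_iff_mem.2 hF.1⟩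
  · intro F hF G hG hne hdvd
    simp only [Finset.mem_filter, Multiset.mem_toFinset] at hF hG
    have hass : Associated F G := (irreducible_of_normalized_factor F hF.1).associated_of_dvd
      (irreducible_of_normalized_factor G hG.1) hdvd
    apply hne
    have := normalize_eq_normalize_iff_associated.2 hass
    rwa [normalize_normalized_factor F hF.1, normalize_normalized_factor G hG.1] at this

lemma count_mod (W : ℝ) (Z : ℤ[X] → ℝ) (𝔉 : Finset ℤ[X]) (hZ0 : ∀ F ∈ 𝔉, 0 ≤ Z F) (hW0 : 0 ≤ W) :
    ∀ X : Finset ℤ[X],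
    (∀ F ∈ 𝔉, ∀ X' ⊆ X, (∀ P ∈ X', ∀ Q ∈ X', P ≠ Q → ¬ F ∣ P - Q) → (X'.card : ℝ) ≤ Z F) →
    (∀ X' ⊆ X, (∀ P ∈ X', ∀ Q ∈ X', ∀ F ∈ 𝔉, F ∣ P - Q) → (X'.card : ℝ) ≤ W) →
    (X.card : ℝ) ≤ W * ∏ F ∈ 𝔉, Z F := by
  classical
  induction 𝔉 using Finset.induction_on with
  | empty =>
    intro X _ h2
    simpa using h2 X subset_rfl (by simp)
  | insert F 𝔉 hF ih =>
    intro X h1 h2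
    let g : ℤ[X] → ℤ[X] ⧸ Ideal.span {F} := Ideal.Quotient.mk (Ideal.span {F})
    have hg : ∀ P Q, g P = g Q ↔ F ∣ P - Q := by
      intro P Q
      rw [Ideal.Quotient.eq, Ideal.mem_span_singleton]
    have hP0 : 0 ≤ ∏ G ∈ 𝔉, Z G :=
      Finset.prod_nonneg fun G hG => hZ0 G (Finset.mem_insert_of_mem hG)
    rw [Finset.card_eq_sum_card_image g X]
    push_cast
    have hfib : ∀ b ∈ X.image g, (((X.filter fun a => g a = b).card : ℕ) : ℝ) ≤ W * ∏ G ∈ 𝔉, Z G := by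
      intro b _
      refine ih (fun G hG => hZ0 G (Finset.mem_insert_of_mem hG)) _ ?_ ?_
      · intro G hG X' hX'
        exact h1 G (Finset.mem_insert_of_mem hG) X' (hX'.trans (Finset.filter_subset _ _))
      · intro X' hX' hc
        refine h2 X' (hX'.trans (Finset.filter_subset _ _)) ?_
        intro P hP Q hQ G hG
        rcases Finset.mem_insert.1 hG with rfl | hG
        · rw [← hg, (Finset.mem_filter.1 (hX' hP)).2, (Finset.mem_filter.1 (hX' hQ)).2]
        · exact hc P hP Q hQ G hG
    have himg : ((X.image g).card : ℝ) ≤ Z F := by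
      obtain ⟨X', hX', hinj, himg⟩ : ∃ X' ⊆ X, Set.InjOn g X' ∧ X'.image g = X.image g := by
        obtain ⟨X', h1, h2, h3⟩ := Finset.exists_subset_injOn_image_eq_of_surjOn (f := g) X (X.image g)
          (by intro b hb; simpa using hb)
        exact ⟨X', h1, h2, h3⟩
      rw [← himg, Finset.card_image_of_injOn hinj]
      refine h1 F (Finset.mem_insert_self _ _) X' hX' ?_
      intro P hP Q hQ hne hd
      exact hne (hinj hP hQ ((hg P Q).2 hd))
    calc _ ≤ ∑ b ∈ X.image g, W * ∏ G ∈ 𝔉, Z G := Finset.sum_le_sum hfib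
      _ = (X.image g).card * (W * ∏ G ∈ 𝔉, Z G) := by simp
      _ ≤ Z F * (W * ∏ G ∈ 𝔉, Z G) := by gcongr
      _ = _ := by rw [Finset.prod_insert hF]; ring

lemma kappa_le (d e f f1 s : ℝ) (hs : 1/2 ≤ s) (hs1 : s ≤ 1) (he : e = 1 ∨ e = 2 ∨ 3 ≤ e) (hf : 1 ≤ f)
    (h1 : f1 ≤ d - (e - 1) * f) (h2 : e * f ≤ d) (hf1 : 1 ≤ f1) :
    -e * (d + 1) * (1 - (1 + s) / 4) + 2 * ((1 + s) / 4) * (e - 1) * ((f + 1) / s)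
      + (1 + s) / 4 * (f1 - 1) ≤ 0 := by
  have he1 : 1 ≤ e := by rcases he with h | h | h <;> linarith
  have hd : 0 ≤ d := by nlinarith
  have hs0 : 0 < s := by linarith
  have a1 : 2 * ((1 + s) / 4) * (e - 1) * ((f + 1) / s) ≤ 3 / 2 * ((e - 1) * (f + 1)) := by
    have : 2 * ((1 + s) / 4) * (e - 1) * ((f + 1) / s) = ((1 + s) / (2 * s)) * ((e - 1) * (f + 1)) := by
      field_simp; ring
    rw [this]
    have h3 : (1 + s) / (2 * s) ≤ 3 / 2 := by rw [div_le_iff₀ (by positivity)]; linarith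
    have h4 : 0 ≤ (e - 1) * (f + 1) := mul_nonneg (by linarith) (by linarith)
    gcongr
  have a2 : -e * (d + 1) * (1 - (1 + s) / 4) ≤ -e * (d + 1) / 2 := by
    have : 0 ≤ e * (d + 1) := mul_nonneg (by linarith) (by linarith)
    nlinarith
  have a3 : (1 + s) / 4 * (f1 - 1) ≤ (d - (e - 1) * f - 1) / 2 := by
    have : (1 + s) / 4 * (f1 - 1) ≤ 1 / 2 * (f1 - 1) := by
      apply mul_le_mul_of_nonneg_right <;> linarith
    linarith
  have a4 : -e * (d + 1) / 2 + 3 / 2 * ((e - 1) * (f + 1)) + (d - (e - 1) * f - 1) / 2 ≤ 0 := by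
    have b1 : (e - 1) * (e * f) ≤ (e - 1) * d := mul_le_mul_of_nonneg_left h2 (by linarith)
    have b2 : (e - 2) * (2 - (e - 1) * f) ≤ 0 := by
      rcases he with rfl | rfl | h
      · norm_num
      · norm_num
      · apply mul_nonpos_of_nonneg_of_nonpos
        · linarith
        · nlinarith
    nlinarith
  linarith

lemma final_lin (d s θ lM lH lδ lh C1 f1 U EU Nn EN V E1 : ℝ) (hθ : θ = (1 + s) / 4) (θ0 : 0 ≤ θ)
    (θ1 : θ ≤ 1 / 2) (hC : 0 ≤ C1) (hdR : 1 ≤ d) (hsum_e : E1 ≤ d)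
    (hA : lM ≤ C1 + (d + 1) * lH + (2 * Nn + (d - 2) * U) - (d - f1 + 1) * U)
    (hB : lM ≤ C1 + (d + 1) * lH - (d + 1) * lh) (h1 : EU ≤ lh + C1)
    (h2 : EN ≤ lh + 2 * lδ + C1) (hN' : -C1 * E1 + (EU - U) - V ≤ EN - Nn)
    (hk' : -(d + 1) * (1 - θ) * EU + 2 * θ * V + θ * (f1 - 1) * U ≤ 0) :
    lM ≤ (2 * d + 3) * C1 + (d + 1) * lH + (1 + s) * lδ := by
  have m1 : lM ≤ C1 + (d + 1) * lH - (1 - θ) * (d + 1) * lh + θ * (2 * Nn + (f1 - 3) * U) := by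
    have p1 := mul_le_mul_of_nonneg_left hA θ0
    have p2 := mul_le_mul_of_nonneg_left hB (by linarith : 0 ≤ 1 - θ)
    linarith
  have m2 : 2 * θ * Nn ≤ 2 * θ * (lh + 2 * lδ + C1 + C1 * E1 - EU + U + V) := by
    apply mul_le_mul_of_nonneg_left _ (by linarith)
    linarith
  have m3 : (2 * θ - (1 - θ) * (d + 1)) * lh ≤ (2 * θ - (1 - θ) * (d + 1)) * (EU - C1) := by
    apply mul_le_mul_of_nonpos_left
    · linarith
    · nlinarith
  have m4 : 2 * θ * C1 * E1 ≤ d * C1 := by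
    have : C1 * E1 ≤ C1 * d := mul_le_mul_of_nonneg_left hsum_e hC
    have h5 : 0 ≤ C1 * d := by positivity
    have h6 := mul_le_mul_of_nonneg_left this θ0
    have h7 := mul_le_mul_of_nonneg_right θ1 h5
    linarith
  have m5 : -(2 * θ - (1 - θ) * (d + 1)) * C1 ≤ (d + 1) * C1 := by
    apply mul_le_mul_of_nonneg_right _ hC
    nlinarith
  have m6 : 2 * θ * C1 ≤ C1 := by
    have := mul_le_mul_of_nonneg_right θ1 hC
    linarith
  have m7 : 4 * θ * lδ = (1 + s) * lδ := by rw [hθ]; ring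
  linarith

lemma final_ineq {ι : Type*} (𝔉 : Finset ι) (e f : ι → ℕ) (u n : ι → ℝ) (d : ℕ) (s lM lH lδ lh C1 : ℝ)
    (hs : 1/2 ≤ s) (hs1 : s ≤ 1) (hC : 0 ≤ C1) (hd : 1 ≤ d)
    (hu : ∀ i ∈ 𝔉, 0 ≤ u i) (he : ∀ i ∈ 𝔉, 1 ≤ e i) (hf : ∀ i ∈ 𝔉, 1 ≤ f i)
    (hdeg : ∑ i ∈ 𝔉, e i * f i ≤ d)
    (hA : lM ≤ C1 + (d + 1) * lH + ∑ i ∈ 𝔉, (2 * n i + (d - 2) * u i)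
      - (d - (∑ i ∈ 𝔉, (f i : ℝ)) + 1) * ∑ i ∈ 𝔉, u i)
    (hB : lM ≤ C1 + (d + 1) * lH - (d + 1) * lh)
    (h1 : ∑ i ∈ 𝔉, e i * u i ≤ lh + C1)
    (h2 : ∑ i ∈ 𝔉, e i * n i ≤ lh + 2 * lδ + C1)
    (hN : ∀ i ∈ 𝔉, 2 ≤ e i → -C1 + (1 - (f i + 1) / s) * u i ≤ n i) :
    lM ≤ (2 * d + 3) * C1 + (d + 1) * lH + (1 + s) * lδ := by
  set θ := (1 + s) / 4 with hθ
  have θ0 : 0 ≤ θ := by rw [hθ]; linarith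
  have θ1 : θ ≤ 1 / 2 := by rw [hθ]; linarith
  set f1 := ∑ i ∈ 𝔉, (f i : ℝ) with hf1
  have hdR : (1:ℝ) ≤ d := by exact_mod_cast hd
  have hdegR : ∑ i ∈ 𝔉, (e i : ℝ) * f i ≤ d := by exact_mod_cast hdeg
  have hsum_e : ∑ i ∈ 𝔉, ((e i : ℝ) - 1) ≤ d := by
    refine le_trans (Finset.sum_le_sum fun i hi => ?_) hdegR
    have a1 : (1:ℝ) ≤ e i := by exact_mod_cast he i hi
    have a2 : (1:ℝ) ≤ f i := by exact_mod_cast hf i hi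
    nlinarith
  -- kappa
  have hk : ∀ i ∈ 𝔉, (-(e i : ℝ) * (d + 1) * (1 - θ) + 2 * θ * (e i - 1) * ((f i + 1) / s)
      + θ * (f1 - 1)) * u i ≤ 0 := by
    intro i hi
    apply mul_nonpos_of_nonpos_of_nonneg _ (hu i hi)
    have a1 : (1:ℝ) ≤ e i := by exact_mod_cast he i hi
    have a2 : (1:ℝ) ≤ f i := by exact_mod_cast hf i hi
    refine kappa_le d (e i) (f i) f1 s hs hs1 ?_ a2 ?_ ?_ ?_
    · have := he i hi
      have : e i = 1 ∨ e i = 2 ∨ 3 ≤ e i := by omega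
      rcases this with h | h | h
      · left; exact_mod_cast h
      · right; left; exact_mod_cast h
      · right; right; exact_mod_cast h
    · have : ∑ j ∈ 𝔉, ((e j : ℝ) * f j - f j) ≥ (e i : ℝ) * f i - f i :=
        Finset.single_le_sum (f := fun j => (e j : ℝ) * f j - f j) (fun j hj => by
          have b1 : (1:ℝ) ≤ e j := by exact_mod_cast he j hj
          have b2 : (1:ℝ) ≤ f j := by exact_mod_cast hf j hj
          nlinarith) hi
      rw [Finset.sum_sub_distrib] at this
      linarith
    · exact le_trans (Finset.single_le_sum (f := fun j => (e j : ℝ) * f j)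
        (fun j _ => by positivity) hi) hdegR
    · exact a2.trans (Finset.single_le_sum (f := fun j => (f j : ℝ)) (fun j _ => by positivity) hi)
  have hk' := Finset.sum_nonpos hk
  -- N
  have hN' : ∑ i ∈ 𝔉, ((e i : ℝ) - 1) * (-C1 + (1 - (f i + 1) / s) * u i) ≤
      ∑ i ∈ 𝔉, ((e i : ℝ) - 1) * n i := by
    refine Finset.sum_le_sum fun i hi => ?_
    have := he i hi
    rcases Nat.lt_or_ge (e i) 2 with h | h
    · have : e i = 1 := by omega
      simp [this]
    · have a1 : (1:ℝ) ≤ e i := by exact_mod_cast he i hi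
      exact mul_le_mul_of_nonneg_left (hN i hi h) (by linarith)
  -- rewrite sums as linear combos
  have e1 : ∑ i ∈ 𝔉, (2 * n i + ((d:ℝ) - 2) * u i) = 2 * ∑ i ∈ 𝔉, n i + (d - 2) * ∑ i ∈ 𝔉, u i := by
    rw [Finset.sum_add_distrib, Finset.mul_sum, Finset.mul_sum]
  have e2 : ∑ i ∈ 𝔉, ((e i : ℝ) - 1) * n i = ∑ i ∈ 𝔉, e i * n i - ∑ i ∈ 𝔉, n i := by
    rw [← Finset.sum_sub_distrib]; exact Finset.sum_congr rfl fun i _ => by ring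
  have e3 : ∑ i ∈ 𝔉, ((e i : ℝ) - 1) * (-C1 + (1 - (f i + 1) / s) * u i) =
      -C1 * ∑ i ∈ 𝔉, ((e i : ℝ) - 1) + (∑ i ∈ 𝔉, (e i : ℝ) * u i - ∑ i ∈ 𝔉, u i)
      - ∑ i ∈ 𝔉, ((e i : ℝ) - 1) * ((f i + 1) / s) * u i := by
    rw [Finset.mul_sum, ← Finset.sum_sub_distrib, ← Finset.sum_add_distrib, ← Finset.sum_sub_distrib]
    exact Finset.sum_congr rfl fun i _ => by ring
  have e4 : ∑ i ∈ 𝔉, (-(e i : ℝ) * (d + 1) * (1 - θ) + 2 * θ * (e i - 1) * ((f i + 1) / s)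
      + θ * (f1 - 1)) * u i = -(d + 1) * (1 - θ) * ∑ i ∈ 𝔉, (e i : ℝ) * u i
      + 2 * θ * ∑ i ∈ 𝔉, ((e i : ℝ) - 1) * ((f i + 1) / s) * u i + θ * (f1 - 1) * ∑ i ∈ 𝔉, u i := by
    rw [Finset.mul_sum, Finset.mul_sum, Finset.mul_sum, ← Finset.sum_add_distrib,
      ← Finset.sum_add_distrib]
    exact Finset.sum_congr rfl fun i _ => by ring
  rw [e1] at hA
  rw [e2, e3] at hN'
  rw [e4] at hk'
  set U := ∑ i ∈ 𝔉, u i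
  set EU := ∑ i ∈ 𝔉, (e i : ℝ) * u i
  set Nn := ∑ i ∈ 𝔉, n i
  set EN := ∑ i ∈ 𝔉, (e i : ℝ) * n i
  set V := ∑ i ∈ 𝔉, ((e i : ℝ) - 1) * ((f i + 1) / s) * u i
  set E1 := ∑ i ∈ 𝔉, ((e i : ℝ) - 1)
  exact final_lin d s θ lM lH lδ lh C1 f1 U EU Nn EN V E1 hθ θ0 θ1 hC hdR hsum_e hA hB h1 h2 hN' hk'

end Bern


namespace Bern
open Polynomial

lemma mm_prod (y ρ : ℝ) (𝔉 : Finset ℤ[X]) (g : ℤ[X] → ℤ[X]) :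
    mm y ρ (∏ F ∈ 𝔉, g F) = ∏ F ∈ 𝔉, mm y ρ (g F) := by
  classical
  induction 𝔉 using Finset.induction_on with
  | empty => simp [mm_one]
  | insert a s ha ih => rw [Finset.prod_insert ha, Finset.prod_insert ha, mm_mul, ih]

lemma mm_pow (y ρ : ℝ) (F : ℤ[X]) (n : ℕ) : mm y ρ (F ^ n) = mm y ρ F ^ n := by
  induction n with
  | zero => simp [mm_one]
  | succ n ih => rw [pow_succ, mm_mul, ih, pow_succ]

/-- product of non-associated irreducibles divides -/
lemma prod_dvd (𝔉 : Finset ℤ[X]) (h1 : ∀ F ∈ 𝔉, Irreducible F)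
    (h2 : ∀ F ∈ 𝔉, ∀ G ∈ 𝔉, F ≠ G → ¬ F ∣ G) (P : ℤ[X]) (hP : ∀ F ∈ 𝔉, F ∣ P) :
    ∏ F ∈ 𝔉, F ∣ P := by
  classical
  induction 𝔉 using Finset.induction_on generalizing P with
  | empty => simp
  | insert a s ha ih =>
    rw [Finset.prod_insert ha]
    obtain ⟨Q, rfl⟩ := hP a (Finset.mem_insert_self _ _)
    apply mul_dvd_mul_left
    refine ih (fun F hF => h1 F (Finset.mem_insert_of_mem hF))
      (fun F hF G hG => h2 F (Finset.mem_insert_of_mem hF) G (Finset.mem_insert_of_mem hG)) Q ?_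
    intro F hF
    have hpr : Prime F := (h1 F (Finset.mem_insert_of_mem hF)).prime
    rcases hpr.dvd_or_dvd (hP F (Finset.mem_insert_of_mem hF)) with h | h
    · exact absurd h (h2 F (Finset.mem_insert_of_mem hF) a (Finset.mem_insert_self _ _)
        (by rintro rfl; exact ha hF))
    · exact h

/-- a class modulo `∏ F` -/
lemma class_size (y : ℝ) {δ : ℝ} (hδ : 0 < δ) (hδ1 : δ ≤ 1) {d : ℕ} {H : ℝ} (R1 : ℤ[X]) (hR1 : R1 ≠ 0)
    (hR1d : R1.natDegree ≤ d) (hB : mm y 1 R1 ≤ 2 * (d + 1) * H)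
    (S : Finset ℤ[X]) (hS : ∀ P ∈ S, P.natDegree ≤ d ∧ ‖ph y δ d P‖ ≤ H)
    (hc : ∀ P ∈ S, ∀ Q ∈ S, R1 ∣ P - Q) :
    (S.card : ℝ) ≤ (3 * (d + 1) * 2 ^ d * (2 * (d + 1) * H / mm y 1 R1)) ^ (d - R1.natDegree + 1) := by
  classical
  have hμ := mm_pos y one_pos hR1
  rcases S.eq_empty_or_nonempty with rfl | ⟨P0, hP0⟩
  · have : 1 ≤ 2 * (d + 1) * H / mm y 1 R1 := by rwa [one_le_div hμ]
    simp only [Finset.card_empty, Nat.cast_zero]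
    positivity
  have : ∀ P : ℤ[X], ∃ Q : ℤ[X], P ∈ S → P - P0 = R1 * Q := by
    intro P
    by_cases hP : P ∈ S
    · obtain ⟨Q, hQ⟩ := hc P hP P0 hP0
      exact ⟨Q, fun _ => hQ⟩
    · exact ⟨0, fun h => absurd h hP⟩
  choose g hg using this
  have hinj : Set.InjOn g S := by
    intro P hP Q hQ h
    have h1 := hg P hP
    have h2 := hg Q hQ
    rw [h, ← h2] at h1
    exact sub_left_inj.1 h1
  rw [← Finset.card_image_of_injOn hinj]
  refine count_mm y (Nat.sub_le d _) (by rwa [one_le_div hμ]) _ ?_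
  intro Q hQ
  obtain ⟨P, hP, rfl⟩ := Finset.mem_image.1 hQ
  have h1 := hg P hP
  have hdeg : (P - P0).natDegree ≤ d := (natDegree_sub_le _ _).trans (max_le (hS P hP).1 (hS P0 hP0).1)
  constructor
  · by_cases h0 : g P = 0
    · simp [h0]
    · rw [h1, natDegree_mul hR1 h0] at hdeg
      omega
  · rw [le_div_iff₀ hμ, mul_comm, ← mm_mul, ← h1]
    refine (mu_le_ph y hδ hδ1 hdeg).trans ?_
    have h3 : ‖ph y δ d (P - P0)‖ ≤ 2 * H := by
      rw [ph_sub]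
      have := norm_sub_le (ph y δ d P) (ph y δ d P0)
      have := (hS P hP).2
      have := (hS P0 hP0).2
      linarith
    calc ((d:ℝ) + 1) * ‖ph y δ d (P - P0)‖ ≤ (d + 1) * (2 * H) := by gcongr
      _ = _ := by ring

set_option maxHeartbeats 4000000 in
theorem keyB (d : ℕ) (hd : 2 ≤ d) (s : ℝ) (hs : 1/2 ≤ s) (hs1 : s ≤ 1) (c : ℝ) (hc : 0 < c) :
    ∃ Cst : ℝ, 0 < Cst ∧ ∀ (y δ H : ℝ), 0 < δ → δ ≤ 1 → 1 ≤ H →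
      (∀ F : ℤ[X], Irreducible F → 0 < F.natDegree → F.natDegree < d →
        c * mm y 1 F ^ (1 - ((F.natDegree : ℝ) + 1) / s) ≤ |tc y F 0|) →
      ∀ S : Finset ℤ[X], (∀ P ∈ S, Irreducible P ∧ P.natDegree = d ∧ 0 < P.leadingCoeff ∧
        ‖ph y δ d P‖ ≤ H) → 2 ≤ S.card → (S.card : ℝ) ≤ Cst * (H ^ (d + 1) * δ ^ (1 + s)) := by
  classical
  set B0 : ℝ := 24 * (d + 1) ^ 2 * 2 ^ d with hB0
  set L := Real.log B0 with hL
  have h2d : (1:ℝ) ≤ 2 ^ d := one_le_pow₀ (by norm_num)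
  have hd1 : (1:ℝ) ≤ (d:ℝ) + 1 := by linarith [(Nat.cast_nonneg d : (0:ℝ) ≤ d)]
  have hd2 : (d:ℝ) + 1 ≤ (d + 1) ^ 2 := by nlinarith
  have hB0a : (4:ℝ) * (d + 1) ≤ B0 := by rw [hB0]; nlinarith
  have hB0b : (6:ℝ) * (d + 1) ^ 2 * 2 ^ d ≤ B0 := by
    rw [hB0]; have : 0 ≤ ((d:ℝ) + 1) ^ 2 * 2 ^ d := by positivity
    nlinarith
  have hB0c : (d:ℝ) + 1 ≤ B0 := by linarith
  have hB0d : (4:ℝ) ≤ B0 := by linarith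
  have L0 : 0 ≤ L := Real.log_nonneg (by linarith)
  set C1 := (2 * d + 1) * L + |Real.log c| with hC1
  have hC10 : 0 ≤ C1 := by positivity
  refine ⟨Real.exp ((2 * d + 3) * C1), Real.exp_pos _, ?_⟩
  intro y δ H hδ hδ1 hH hN S hS hcard
  have hH0 : 0 < H := by linarith
  -- minimal difference
  obtain ⟨P0, hP0, P1, hP1, hne⟩ := Finset.one_lt_card.1 hcard
  obtain ⟨⟨Pa, Pb⟩, hab, hmin⟩ := Finset.exists_min_image S.offDiag
    (fun p => ‖ph y δ d (p.1 - p.2)‖) ⟨(P0, P1), by simp [hP0, hP1, hne]⟩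
  simp only [Finset.mem_offDiag] at hab hmin
  obtain ⟨hPa, hPb, hPab⟩ := hab
  set R := Pa - Pb with hR
  have hR0 : R ≠ 0 := sub_ne_zero.2 hPab
  set h := ‖ph y δ d R‖ with hh
  have hdS : ∀ P ∈ S, P.natDegree ≤ d := fun P hP => (hS P hP).2.1.le
  have hRd : R.natDegree ≤ d := (natDegree_sub_le _ _).trans (max_le (hdS Pa hPa) (hdS Pb hPb))
  have hμR : mm y 1 R ≤ (d + 1) * h := mu_le_ph y hδ hδ1 hRd
  have hνR : mm y δ R ≤ (d + 1) * (h * δ ^ 2) := nu_le_ph y hδ hδ1 hRd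
  have h1R := one_le_mm y hR0
  have hh0 : 0 < h := by
    have : 0 < ((d:ℝ) + 1) * h := by linarith
    exact pos_of_mul_pos_right this (by positivity)
  have hhH : h ≤ 2 * H := by
    rw [hh, hR, ph_sub]
    have := norm_sub_le (ph y δ d Pa) (ph y δ d Pb)
    have := (hS Pa hPa).2.2.2
    have := (hS Pb hPb).2.2.2
    linarith
  obtain ⟨𝔉, e, a, ha0, hfact, hF, hFF⟩ := exists_fact hR0
  have hFne : ∀ F ∈ 𝔉, F ≠ 0 := fun F h => (hF F h).1.ne_zero
  have ha1 : 1 ≤ |(a:ℝ)| := by rw [← Int.cast_abs]; exact_mod_cast Int.one_le_abs ha0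
  set u : ℤ[X] → ℝ := fun F => Real.log (mm y 1 F) with hu
  set n : ℤ[X] → ℝ := fun F => Real.log (mm y δ F) with hn
  have hμpos : ∀ F ∈ 𝔉, 0 < mm y 1 F := fun F h => mm_pos y one_pos (hFne F h)
  have hνpos : ∀ F ∈ 𝔉, 0 < mm y δ F := fun F h => mm_pos y hδ (hFne F h)
  set R1 := ∏ F ∈ 𝔉, F with hR1
  have hR1ne : R1 ≠ 0 := Finset.prod_ne_zero_iff.2 hFne
  have hR1deg : R1.natDegree = ∑ F ∈ 𝔉, F.natDegree := natDegree_prod _ _ hFne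
  have hdeg : ∑ F ∈ 𝔉, e F * F.natDegree ≤ d := by
    have : R.natDegree = ∑ F ∈ 𝔉, e F * F.natDegree := by
      rw [hfact, natDegree_C_mul ha0, natDegree_prod _ _ (fun F h => pow_ne_zero _ (hFne F h))]
      exact Finset.sum_congr rfl fun F _ => natDegree_pow _ _
    omega
  have hR1d : R1.natDegree ≤ d := by
    rw [hR1deg]
    refine le_trans (Finset.sum_le_sum fun F h => ?_) hdeg
    exact Nat.le_mul_of_pos_left _ (hF F h).2.2
  have hmmR : ∀ ρ, mm y ρ R = |(a:ℝ)| * ∏ F ∈ 𝔉, mm y ρ F ^ e F := by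
    intro ρ
    rw [hfact, mm_mul, mm_C, mm_prod]
    congr 1
    exact Finset.prod_congr rfl fun F _ => mm_pow _ _ _ _
  have hμR1 : mm y 1 R1 ≤ 2 * (d + 1) * H := by
    have : mm y 1 R1 ≤ mm y 1 R := by
      rw [hmmR, hR1, mm_prod]
      calc ∏ F ∈ 𝔉, mm y 1 F ≤ ∏ F ∈ 𝔉, mm y 1 F ^ e F :=
            Finset.prod_le_prod (fun F h => (hμpos F h).le) fun F h =>
              le_self_pow₀ (one_le_mm y (hFne F h)) (by have := (hF F h).2.2; omega)
        _ ≤ _ := le_mul_of_one_le_left (Finset.prod_nonneg fun F h => by have := hμpos F h; positivity) ha1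
    calc _ ≤ _ := this
      _ ≤ (d + 1) * h := hμR
      _ ≤ (d + 1) * (2 * H) := by gcongr
      _ = _ := by ring
  have hMpos : (0:ℝ) < S.card := by exact_mod_cast (by omega : 0 < S.card)
  -- the bound A
  set Z : ℤ[X] → ℝ := fun F => (4 * (d + 1) * H) ^ F.natDegree * (mm y δ F ^ 2 * mm y 1 F ^ (d - 2)) with hZ
  have hZpos : ∀ F ∈ 𝔉, 0 < Z F := fun F h => by
    have := hμpos F h
    have := hνpos F h
    positivity
  have hμ1pos := mm_pos y one_pos hR1ne
  set W := (3 * ((d:ℝ) + 1) * 2 ^ d * (2 * (d + 1) * H / mm y 1 R1)) ^ (d - R1.natDegree + 1) with hW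
  have hWpos : 0 < W := by positivity
  have hA0 : (S.card : ℝ) ≤ W * ∏ F ∈ 𝔉, Z F := by
    refine count_mod W Z 𝔉 (fun F h => (hZpos F h).le) hWpos.le S ?_ ?_
    · intro F hFm X' hX' hsep
      rcases Nat.lt_or_ge X'.card 2 with hlt | hge
      · have h1 : (X'.card : ℝ) ≤ 1 := by exact_mod_cast (by omega : X'.card ≤ 1)
        refine h1.trans ?_
        obtain ⟨P, hP, hFP⟩ : ∃ P ∈ S, ¬ F ∣ P := by
          by_contra hcon
          push Not at hcon
          have hx0 := (hF F hFm).1.associated_of_dvd (hS P0 hP0).1 (hcon P0 hP0)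
          have hx1 := (hF F hFm).1.associated_of_dvd (hS P1 hP1).1 (hcon P1 hP1)
          exact hne (eq_of_dvd (hS P0 hP0).1 (hS P1 hP1).1 (hS P0 hP0).2.2.1 (hS P1 hP1).2.2.1
            (hx0.symm.trans hx1).dvd)
        refine (res_le y hδ hd (hF F hFm).1 (hF F hFm).2.1 hFP (hdS P hP) (hS P hP).2.2.2).trans ?_
        have := hμpos F hFm
        simp only [hZ]
        gcongr
        nlinarith
      · exact classes y hδ hd (hF F hFm).1 (hF F hFm).2.1 X'
          (fun P hP => ⟨hdS P (hX' hP), (hS P (hX' hP)).2.2.2⟩) hsep hge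
    · intro X' hX' hcong
      refine class_size y hδ hδ1 R1 hR1ne hR1d hμR1 X'
        (fun P hP => ⟨hdS P (hX' hP), (hS P (hX' hP)).2.2.2⟩) ?_
      intro P hP Q hQ
      exact prod_dvd 𝔉 (fun F h => (hF F h).1) hFF _ (fun F h => hcong P hP Q hQ F h)
  have hlμ1 : Real.log (mm y 1 R1) = ∑ F ∈ 𝔉, u F := by
    rw [hR1, mm_prod, Real.log_prod (fun F h => (hμpos F h).ne')]
  set f1 : ℝ := ∑ F ∈ 𝔉, (F.natDegree : ℝ) with hf1
  have hf1' : (R1.natDegree : ℝ) = f1 := by rw [hR1deg]; push_cast; rfl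
  have hf1d : f1 ≤ d := by rw [← hf1']; exact_mod_cast hR1d
  have hf10 : 0 ≤ f1 := by rw [← hf1']; positivity
  have hA : Real.log S.card ≤ C1 + (d + 1) * Real.log H + ∑ i ∈ 𝔉, (2 * n i + ((d:ℝ) - 2) * u i)
      - (d - (∑ i ∈ 𝔉, (i.natDegree : ℝ)) + 1) * ∑ i ∈ 𝔉, u i := by
    have hl := Real.log_le_log hMpos hA0
    rw [Real.log_mul hWpos.ne' (Finset.prod_ne_zero_iff.2 fun F h => (hZpos F h).ne'),
      Real.log_prod (fun F h => (hZpos F h).ne')] at hl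
    have eW : Real.log W = (d - f1 + 1) * (Real.log (6 * (d + 1) ^ 2 * 2 ^ d) + Real.log H - ∑ F ∈ 𝔉, u F) := by
      rw [hW, Real.log_pow]
      push_cast [Nat.cast_sub hR1d]
      rw [hf1']
      congr 1
      rw [← hlμ1, ← Real.log_mul (by positivity) (by positivity), ← Real.log_div (by positivity) (by positivity)]
      congr 1
      ring
    have eZ : ∀ F ∈ 𝔉, Real.log (Z F) ≤ F.natDegree * (L + Real.log H) + (2 * n F + (d - 2) * u F) := by
      intro F h
      have p1 := hμpos F h
      have p2 := hνpos F h
      simp only [hZ]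
      rw [Real.log_mul (by positivity) (by positivity), Real.log_mul (by positivity) (by positivity),
        Real.log_pow, Real.log_pow, Real.log_pow, Real.log_mul (by positivity) (by positivity)]
      push_cast [Nat.cast_sub hd]
      have : Real.log (4 * (d + 1)) ≤ L := Real.log_le_log (by positivity) hB0a
      gcongr
    have hZs := Finset.sum_le_sum eZ
    rw [Finset.sum_add_distrib, ← Finset.sum_mul] at hZs
    rw [eW] at hl
    have hW2 : (d - f1 + 1) * (Real.log (6 * (d + 1) ^ 2 * 2 ^ d) + Real.log H - ∑ F ∈ 𝔉, u F) ≤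
        (d - f1 + 1) * (L + Real.log H - ∑ F ∈ 𝔉, u F) := by
      have : Real.log (6 * (d + 1) ^ 2 * 2 ^ d) ≤ L := Real.log_le_log (by positivity) hB0b
      apply mul_le_mul_of_nonneg_left _ (by linarith)
      linarith
    have hLc : ((d:ℝ) - f1 + 1) * L + f1 * L ≤ C1 := by
      rw [hC1]
      have := abs_nonneg (Real.log c)
      have hdd : (0:ℝ) ≤ d := Nat.cast_nonneg d
      nlinarith
    linarith
  have hB : Real.log S.card ≤ C1 + (d + 1) * Real.log H - (d + 1) * Real.log h := by
    have hp := pack' S (ph y δ d) H h (d + 1) (by simp) hh0 hH0.le (fun P hP => (hS P hP).2.2.2)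
      (fun P hP Q hQ hPQ => by
        rw [← ph_sub]; exact hmin (P, Q) ⟨hP, hQ, hPQ⟩)
    have hp2 : (S.card : ℝ) ≤ (4 * H / h) ^ (d + 1) := by
      refine hp.trans ?_
      have : 1 ≤ 2 * H / h := by rwa [one_le_div hh0]
      have e : 4 * H / h = 2 * (2 * H / h) := by ring
      rw [e]
      gcongr
      linarith
    have hl := Real.log_le_log hMpos hp2
    rw [Real.log_pow, Real.log_div (by positivity) hh0.ne', Real.log_mul (by norm_num) hH0.ne'] at hl
    have h4 : Real.log 4 ≤ L := Real.log_le_log (by norm_num) hB0d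
    have : ((d:ℝ) + 1) * Real.log 4 ≤ C1 := by
      rw [hC1]
      have := abs_nonneg (Real.log c)
      have hdd : (0:ℝ) ≤ d := Nat.cast_nonneg d
      nlinarith
    push_cast at hl
    linarith
  have hLC : L ≤ C1 := by
    rw [hC1]
    have := abs_nonneg (Real.log c)
    have hdd : (0:ℝ) ≤ d := Nat.cast_nonneg d
    nlinarith
  have hld : Real.log (d + 1) ≤ L := Real.log_le_log (by positivity) hB0c
  have hlogR : ∀ ρ, 0 < ρ → ∑ F ∈ 𝔉, (e F : ℝ) * Real.log (mm y ρ F) ≤ Real.log (mm y ρ R) := by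
    intro ρ hρ
    have hpos : ∀ F ∈ 𝔉, 0 < mm y ρ F := fun F h => mm_pos y hρ (hFne F h)
    have hpp : ∀ F ∈ 𝔉, mm y ρ F ^ e F ≠ 0 := fun F h => (pow_pos (hpos F h) _).ne'
    rw [hmmR, Real.log_mul (by positivity) (Finset.prod_ne_zero_iff.2 hpp), Real.log_prod hpp]
    simp_rw [Real.log_pow]
    have := Real.log_nonneg ha1
    linarith
  have h1 : ∑ i ∈ 𝔉, e i * u i ≤ Real.log h + C1 := by
    refine (hlogR 1 one_pos).trans ?_
    have hl := Real.log_le_log (by linarith) hμR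
    rw [Real.log_mul (by positivity) hh0.ne'] at hl
    linarith
  have h2 : ∑ i ∈ 𝔉, e i * n i ≤ Real.log h + 2 * Real.log δ + C1 := by
    refine (hlogR δ hδ).trans ?_
    have hl := Real.log_le_log (mm_pos y hδ hR0) hνR
    rw [Real.log_mul (by positivity) (by positivity), Real.log_mul hh0.ne' (by positivity),
      Real.log_pow] at hl
    push_cast at hl
    linarith
  have hN' : ∀ F ∈ 𝔉, 2 ≤ e F → -C1 + (1 - ((F.natDegree:ℝ) + 1) / s) * u F ≤ n F := by
    intro F h he
    have hlt : F.natDegree < d := by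
      have h3 : e F * F.natDegree ≤ d :=
        (Finset.single_le_sum (f := fun F => e F * F.natDegree) (fun _ _ => Nat.zero_le _) h).trans hdeg
      have h4 := (hF F h).2.1
      nlinarith
    have h5 := (hN F (hF F h).1 (hF F h).2.1 hlt).trans (tc_zero_le y hδ F)
    have hp := Real.rpow_pos_of_pos (hμpos F h) (1 - ((F.natDegree:ℝ) + 1) / s)
    have h6 := Real.log_le_log (by positivity) h5
    rw [Real.log_mul hc.ne' hp.ne', Real.log_rpow (hμpos F h)] at h6
    have h7 := neg_abs_le (Real.log c)
    have h8 : |Real.log c| ≤ C1 := by rw [hC1]; have : 0 ≤ (2 * (d:ℝ) + 1) * L := by positivity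
                                      linarith
    simp only [hu, hn]
    linarith
  have fin := final_ineq 𝔉 e (fun F => F.natDegree) u n d s (Real.log S.card) (Real.log H) (Real.log δ)
    (Real.log h) C1 hs hs1 hC10 (by omega) (fun F h => Real.log_nonneg (one_le_mm y (hFne F h)))
    (fun F h => (hF F h).2.2) (fun F h => (hF F h).2.1) hdeg hA hB h1 h2 hN'
  have := Real.exp_le_exp.2 fin
  rw [Real.exp_log hMpos, Real.exp_add, Real.exp_add] at this
  refine this.trans (le_of_eq ?_)
  rw [mul_assoc]
  congr 2
  · have : ((d:ℝ) + 1) * Real.log H = Real.log (H ^ (d + 1)) := by rw [Real.log_pow]; push_cast; rfl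
    rw [this, Real.exp_log (by positivity)]
  · rw [Real.rpow_def_of_pos hδ, mul_comm]

/-- two distinct members give a lower bound -/
theorem keyA (d : ℕ) (hd : 2 ≤ d) (y δ H : ℝ) (hδ : 0 < δ) (hδ1 : δ ≤ 1) (hH : 0 ≤ H)
    (P Q : ℤ[X]) (hP : Irreducible P ∧ P.natDegree = d ∧ 0 < P.leadingCoeff ∧ ‖ph y δ d P‖ ≤ H)
    (hQ : Irreducible Q ∧ Q.natDegree = d ∧ 0 < Q.leadingCoeff ∧ ‖ph y δ d Q‖ ≤ H) (hne : P ≠ Q) :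
    1 ≤ ((d + 1) * H) ^ (2 * d) * δ ^ 4 := by
  have h := res_le y hδ hd hP.1 (by omega) (Y := Q)
    (fun h => hne (eq_of_dvd hP.1 hQ.1 hP.2.2.1 hQ.2.2.1 h)) hQ.2.1.le hQ.2.2.2
  refine h.trans ?_
  have h1 : mm y 1 P ≤ (d + 1) * H := (mu_le_ph y hδ hδ1 hP.2.1.le).trans (by gcongr; exact hP.2.2.2)
  have h2 : mm y δ P ≤ (d + 1) * H * δ ^ 2 := by
    refine (nu_le_ph y hδ hδ1 hP.2.1.le).trans ?_
    have := hP.2.2.2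
    rw [mul_assoc]
    gcongr
  have p1 := mm_nonneg y 1 P
  have p2 := mm_nonneg y δ P
  rw [hP.2.1]
  calc _ ≤ ((d + 1) * H) ^ d * (((d + 1) * H * δ ^ 2) ^ 2 * ((d + 1) * H) ^ (d - 2)) := by gcongr
    _ = ((d + 1) * H) ^ (d + 2 + (d - 2)) * δ ^ 4 := by rw [pow_add, pow_add]; ring
    _ = _ := by congr 2; omega

end Bern


namespace Bern
open Polynomial

lemma group_count {α : Type*} (𝓕 : Finset α) (x : α → ℝ) {K L B : ℝ} (hK0 : 0 ≤ K)
    (hK : ∀ F ∈ 𝓕, |x F| ≤ K) (hL : 0 < L) (hL1 : L ≤ 1) (hB0 : 0 ≤ B)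
    (hB : ∀ 𝓖 ⊆ 𝓕, ∀ F0 ∈ 𝓖, (∀ F ∈ 𝓖, |x F0 - x F| ≤ L) → (𝓖.card : ℝ) ≤ B) :
    (𝓕.card : ℝ) ≤ (2 * K + 2) / L * B := by
  classical
  set g : α → ℤ := fun F => ⌊x F / L⌋ with hg
  have h1 : (𝓕.card : ℝ) ≤ ((𝓕.image g).card : ℝ) * B := by
    rw [Finset.card_eq_sum_card_image g 𝓕]
    push_cast
    calc _ ≤ ∑ b ∈ 𝓕.image g, B := by
          apply Finset.sum_le_sum
          intro b hb
          obtain ⟨F0, hF0, rfl⟩ := Finset.mem_image.1 hb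
          refine hB _ (Finset.filter_subset _ _) F0 (by simp [hF0]) ?_
          intro F hF
          have h := (Finset.mem_filter.1 hF).2
          have h2 := Int.abs_sub_lt_one_of_floor_eq_floor (hg ▸ h)
          rw [← sub_div, abs_div, abs_of_pos hL, div_lt_one hL, abs_sub_comm] at h2
          exact h2.le
      _ = _ := by simp
  have h2 : ((𝓕.image g).card : ℝ) ≤ (2 * K + 2) / L := by
    have hs : 𝓕.image g ⊆ Finset.Icc (-⌈K / L⌉) ⌊K / L⌋ := by
      intro b hb
      obtain ⟨F, hF, rfl⟩ := Finset.mem_image.1 hb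
      have := abs_le.1 (hK F hF)
      rw [Finset.mem_Icc, hg]
      constructor
      · rw [Int.le_floor]
        push_cast
        have h3 := Int.le_ceil (K / L)
        have : -(K / L) ≤ x F / L := by rw [← neg_div]; gcongr; exact this.1
        linarith
      · exact Int.floor_le_floor (by gcongr; exact this.2)
    have h3 := Finset.card_le_card hs
    rw [Int.card_Icc] at h3
    have hKL : 0 ≤ K / L := by positivity
    have h4 : ((⌊K / L⌋ + 1 - -⌈K / L⌉).toNat : ℤ) = ⌊K / L⌋ + 1 - -⌈K / L⌉ := by
      apply Int.toNat_of_nonneg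
      have := Int.floor_nonneg.2 hKL
      have := Int.ceil_nonneg hKL
      omega
    have h5 : ((𝓕.image g).card : ℝ) ≤ ((⌊K / L⌋ + 1 - -⌈K / L⌉ : ℤ) : ℝ) := by
      rw [← h4]; exact_mod_cast h3
    refine h5.trans ?_
    push_cast
    have h6 := Int.floor_le (K / L)
    have h7 := Int.ceil_lt_add_one (K / L)
    have h8 : (2 * K + 2) / L = 2 * (K / L) + 2 / L := by ring
    have h9 : 2 ≤ 2 / L := by rw [le_div_iff₀ hL]; linarith
    linarith
  exact h1.trans (by gcongr)

lemma tc_shift_le {x y L b : ℝ} {F : ℤ[X]} {d j : ℕ} (hd : F.natDegree ≤ d) (hxy : |y - x| ≤ L)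
    (hb0 : 0 ≤ b) (hb : ∀ k ≤ d, j ≤ k → |tc x F k| * L ^ (k - j) ≤ b) :
    |tc y F j| ≤ (d + 1) * 2 ^ d * b := by
  rw [tc_shift x y F d hd j]
  refine (Finset.abs_sum_le_sum_abs _ _).trans ?_
  calc _ ≤ ∑ k ∈ Finset.range (d + 1), (2:ℝ) ^ d * b := by
        apply Finset.sum_le_sum
        intro k hk
        have hk' : k ≤ d := by simpa [Nat.lt_succ_iff] using hk
        rcases lt_or_ge k j with h | h
        · rw [Nat.choose_eq_zero_of_lt h]; simp; positivity
        · rw [abs_mul, abs_mul, abs_pow, Nat.abs_cast, mul_assoc]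
          have h1 : ((k.choose j : ℕ) : ℝ) ≤ 2 ^ d := by
            have h2 : k.choose j ≤ 2 ^ k := Nat.choose_le_two_pow k j
            have h3 : 2 ^ k ≤ 2 ^ d := Nat.pow_le_pow_right (by norm_num) hk'
            exact_mod_cast h2.trans h3
          have h4 : |tc x F k| * |y - x| ^ (k - j) ≤ b := by
            refine le_trans ?_ (hb k hk' h)
            gcongr
          gcongr
    _ = _ := by simp; ring

lemma shift_ph1 {x y L δ t : ℝ} {F : ℤ[X]} {d : ℕ} (hd : F.natDegree ≤ d) (hxy : |y - x| ≤ L)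
    (hL : 0 < L) (hLδ : L ≤ δ) (hδ1 : δ ≤ 1) (ht : 0 ≤ t)
    (h : ∀ k ≤ d, |tc x F k| ≤ t * δ ^ (2 - k)) : ‖ph y δ d F‖ ≤ (d + 1) * 2 ^ d * t := by
  have hδ : 0 < δ := hL.trans_le hLδ
  apply ph_le hδ (by positivity)
  intro j hj
  rw [mul_assoc]
  apply tc_shift_le hd hxy (by positivity)
  intro k hk hjk
  calc |tc x F k| * L ^ (k - j) ≤ t * δ ^ (2 - k) * δ ^ (k - j) := by
        gcongr; exact h k hk
    _ = t * δ ^ ((2 - k) + (k - j)) := by rw [pow_add]; ring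
    _ ≤ t * δ ^ (2 - j) := by
        gcongr 1
        exact pow_le_pow_of_le_one hδ.le hδ1 (by omega)

lemma shift_ph2 {x y L δ t : ℝ} {F : ℤ[X]} {d : ℕ} (hd : F.natDegree ≤ d) (hxy : |y - x| ≤ L)
    (hδ : 0 < δ) (hLδ : δ ≤ L) (hL1 : L ≤ 1) (ht : 0 ≤ t)
    (h : ∀ k ≤ d, |tc x F k| ≤ t) (h' : ∀ k ≤ d, |tc x F k| * L ^ k ≤ t * δ ^ 2) :
    ‖ph y δ d F‖ ≤ (d + 1) * 2 ^ d * t := by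
  have hL : 0 < L := hδ.trans_le hLδ
  apply ph_le hδ (by positivity)
  intro j hj
  rw [mul_assoc]
  apply tc_shift_le hd hxy (by positivity)
  intro k hk hjk
  match j, hjk with
  | 0, _ => simpa using h' k hk
  | 1, hjk =>
    have h1 := h' k hk
    have e : L ^ k = L ^ (k - 1) * L := by rw [← pow_succ]; congr 1; omega
    rw [e, ← mul_assoc] at h1
    have h2 : |tc x F k| * L ^ (k - 1) * L ≤ (t * δ) * L := h1.trans (by
      rw [sq, ← mul_assoc]; gcongr)
    simpa using le_of_mul_le_mul_right h2 hL
  | (j+2), hjk =>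
    have : |tc x F k| * L ^ (k - (j + 2)) ≤ t * 1 := by
      gcongr
      · exact h k hk
      · exact pow_le_one₀ hL.le hL1
    simpa using this

lemma interp {a M z w θ : ℝ} (ha : 0 ≤ a) (haM : a ≤ M) (hz : 0 < z) (hw : 0 < w)
    (h : a * z ≤ M * w) (hθ : 0 ≤ θ) (hθ1 : θ ≤ 1) : a * z ^ θ ≤ M * w ^ θ := by
  rcases ha.eq_or_lt with h0 | h0
  · rw [← h0, zero_mul]
    have : 0 ≤ M := ha.trans haM
    positivity
  · have h1 : 1 ≤ M / a := by rwa [one_le_div h0]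
    have h2 : z ≤ (M / a) * w := by
      rw [div_mul_eq_mul_div, le_div_iff₀ h0]; linarith
    have h3 : z ^ θ ≤ (M / a) * w ^ θ := by
      calc z ^ θ ≤ ((M / a) * w) ^ θ := Real.rpow_le_rpow hz.le h2 hθ
        _ = (M / a) ^ θ * w ^ θ := Real.mul_rpow (by linarith) hw.le
        _ ≤ (M / a) * w ^ θ := by
          gcongr
          exact Real.rpow_le_self_of_one_le h1 hθ1
    calc a * z ^ θ ≤ a * ((M / a) * w ^ θ) := by gcongr
      _ = _ := by field_simp

lemma sizeA {d : ℕ} (hd : 2 ≤ d) {y δ H C1 : ℝ} (hδ : 0 < δ) (hδ1 : δ ≤ 1) (hH : 1 ≤ H) (hC1 : 0 ≤ C1)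
    (hδH : δ ^ 4 * H ^ (2 * d + 1) = 1) (hlarge : ((d + 1) * C1) ^ (2 * d) < H)
    (S : Finset ℤ[X]) (hS : ∀ P ∈ S, Irreducible P ∧ P.natDegree = d ∧ 0 < P.leadingCoeff ∧
        ‖ph y δ d P‖ ≤ C1 * H) : (S.card : ℝ) ≤ 1 := by
  have : S.card ≤ 1 := by
    rw [Finset.card_le_one]
    intro P hP Q hQ
    by_contra hne
    have h := keyA d hd y δ (C1 * H) hδ hδ1 (by positivity) P Q (hS P hP) (hS Q hQ) hne
    have e : ((d + 1) * (C1 * H)) ^ (2 * d) * δ ^ 4 * H = ((d + 1) * C1) ^ (2 * d) := by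
      calc _ = ((d + 1) * C1) ^ (2 * d) * (δ ^ 4 * H ^ (2 * d + 1)) := by
              rw [← mul_assoc ((d:ℝ) + 1), mul_pow _ H, pow_succ H]; ring
        _ = _ := by rw [hδH, mul_one]
    have : 1 * H ≤ ((d + 1) * (C1 * H)) ^ (2 * d) * δ ^ 4 * H := by gcongr
    linarith
  exact_mod_cast this

set_option maxHeartbeats 1000000 in
theorem count_class (d : ℕ) (s : ℝ) (hs : 1/2 ≤ s) (hs1 : s ≤ 1) (c : ℝ) (hc : 0 < c)
    (K : ℝ) (hK0 : 0 ≤ K) (C0 : ℝ) (hC0 : 1 ≤ C0) :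
    ∃ Cst : ℝ, 0 < Cst ∧ ∀ (H ε r : ℝ), 1 ≤ H → ε = H ^ (-(((d : ℝ) + 1) / s)) → 0 < r → r ≤ 1 →
      (2 ≤ d ∨ r ≤ 4 * ε) → ∀ (𝓕 : Finset ℤ[X]) (x : ℤ[X] → ℝ),
      (∀ F ∈ 𝓕, Irreducible F ∧ F.natDegree = d ∧ 0 < F.leadingCoeff) →
      (∀ F ∈ 𝓕, |x F| ≤ K) →
      (∀ F ∈ 𝓕, mm (x F) 1 F ≤ C0 * H) →
      (∀ F ∈ 𝓕, ∀ j ≤ d, |tc (x F) F j| ≤ C0 * H) →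
      (∀ F ∈ 𝓕, ∀ j ≤ d, |tc (x F) F j| * r ^ j ≤ C0 * H * ε) →
      (∀ F ∈ 𝓕, ∀ G : ℤ[X], Irreducible G → 0 < G.natDegree → G.natDegree < d →
        c * mm (x F) 1 G ^ (1 - ((G.natDegree : ℝ) + 1) / s) ≤ |tc (x F) G 0|) →
      (𝓕.card : ℝ) ≤ Cst * r ^ (-s) := by
  have hs0 : 0 < s := by linarith
  have hKB : ∃ CB : ℝ, 0 < CB ∧ (2 ≤ d → ∀ (y δ H : ℝ), 0 < δ → δ ≤ 1 → 1 ≤ H →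
      (∀ F : ℤ[X], Irreducible F → 0 < F.natDegree → F.natDegree < d →
        c * mm y 1 F ^ (1 - ((F.natDegree : ℝ) + 1) / s) ≤ |tc y F 0|) →
      ∀ S : Finset ℤ[X], (∀ P ∈ S, Irreducible P ∧ P.natDegree = d ∧ 0 < P.leadingCoeff ∧
        ‖ph y δ d P‖ ≤ H) → 2 ≤ S.card → (S.card : ℝ) ≤ CB * (H ^ (d + 1) * δ ^ (1 + s))) := by
    by_cases hd : 2 ≤ d
    · obtain ⟨CB, h, h'⟩ := keyB d hd s hs hs1 c hc
      exact ⟨CB, h, fun _ => h'⟩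
    · exact ⟨1, one_pos, fun h => absurd h hd⟩
  obtain ⟨CB, hCB, hB⟩ := hKB
  set C1 : ℝ := (d + 1) * 2 ^ d * C0 with hC1
  set C2 : ℝ := max 1 (((d + 1) * C1) ^ (2 * d)) with hC2
  set A : ℝ := 3 * (d + 1) * 2 ^ d * ((1 + K) ^ d * C0) with hA
  have hC1p : 0 < C1 := by positivity
  have hC11 : 1 ≤ C1 := by
    have h2d : (1:ℝ) ≤ 2 ^ d := one_le_pow₀ (by norm_num)
    have hd1 : (1:ℝ) ≤ (d:ℝ) + 1 := by linarith [(Nat.cast_nonneg d : (0:ℝ) ≤ d)]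
    have := one_le_mul_of_one_le_of_one_le hd1 h2d
    exact one_le_mul_of_one_le_of_one_le this hC0
  have hC2p : 1 ≤ C2 := le_max_left _ _
  have hAp : 0 < A := by positivity
  set E1 : ℝ := (A * C2) ^ (d + 1)
  set E2 : ℝ := A ^ (d + 1) * 4
  set E3 : ℝ := (2 * K + 2) * (1 + CB * C1 ^ (d + 1))
  have hE1 : 0 < E1 := by positivity
  have hE2 : 0 < E2 := by positivity
  have hE3 : 0 < E3 := by positivity
  refine ⟨E1 + E2 + E3, by positivity, ?_⟩
  intro H ε r hH hε hr hr1 hdr 𝓕 x hF hK hmm htc htc' hlow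
  have hH0 : 0 < H := by linarith
  have hrs : 1 ≤ r ^ (-s) := Real.one_le_rpow_of_pos_of_le_one_of_nonpos hr hr1 (by linarith)
  have hrs0 : 0 < r ^ (-s) := by linarith
  have add1 : ∀ X : ℝ, X ≤ E1 * r ^ (-s) ∨ X ≤ E2 * r ^ (-s) ∨ X ≤ E3 * r ^ (-s) →
      X ≤ (E1 + E2 + E3) * r ^ (-s) := by
    intro X hX
    have := mul_pos hE1 hrs0
    have := mul_pos hE2 hrs0
    have := mul_pos hE3 hrs0
    rcases hX with h | h | h <;> nlinarith
  apply add1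
  have hcount : (𝓕.card : ℝ) ≤ (A * H) ^ (d + 1) := by
    have := count_mm 0 le_rfl (d := d) (e := d) (B := (1 + K) ^ d * (C0 * H))
      (one_le_mul_of_one_le_of_one_le (one_le_pow₀ (by linarith))
        (one_le_mul_of_one_le_of_one_le hC0 hH)) 𝓕 (fun P hP => by
        refine ⟨(hF P hP).2.1.le, (mm_compare 0 (x P) K (by simpa using hK P hP) P).trans ?_⟩
        rw [(hF P hP).2.1]
        gcongr
        exact hmm P hP)
    refine this.trans (le_of_eq ?_)
    rw [hA]; ring
  by_cases hHC : H ≤ C2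
  · left
    calc (𝓕.card : ℝ) ≤ (A * H) ^ (d + 1) := hcount
      _ ≤ (A * C2) ^ (d + 1) := by gcongr
      _ = E1 * 1 := by simp [E1]
      _ ≤ E1 * r ^ (-s) := by gcongr
  push Not at hHC
  have hε0 : 0 < ε := by rw [hε]; positivity
  have hdd : (0:ℝ) ≤ d := Nat.cast_nonneg d
  have hε1 : ε ≤ 1 := by
    rw [hε]; apply Real.rpow_le_one_of_one_le_of_nonpos hH
    have : 0 ≤ ((d:ℝ) + 1) / s := by positivity
    linarith
  have hεs : ε ^ s * H ^ (d + 1) = 1 := by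
    rw [hε, ← Real.rpow_mul hH0.le, ← Real.rpow_natCast, ← Real.rpow_add hH0]
    have : -(((d:ℝ) + 1) / s) * s + ((d + 1 : ℕ) : ℝ) = 0 := by
      push_cast; field_simp; ring
    rw [this, Real.rpow_zero]
  by_cases hrε : r ≤ 4 * ε
  · right; left
    have h1 : r ^ s ≤ 4 * ε ^ s := by
      calc r ^ s ≤ (4 * ε) ^ s := Real.rpow_le_rpow hr.le hrε hs0.le
        _ = 4 ^ s * ε ^ s := Real.mul_rpow (by norm_num) hε0.le
        _ ≤ 4 * ε ^ s := by
          gcongr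
          exact Real.rpow_le_self_of_one_le (by norm_num) hs1
    have h2 : H ^ (d + 1) * r ^ s ≤ 4 := by
      calc H ^ (d + 1) * r ^ s ≤ H ^ (d + 1) * (4 * ε ^ s) := by gcongr
        _ = 4 * (ε ^ s * H ^ (d + 1)) := by ring
        _ = 4 := by rw [hεs]; ring
    rw [Real.rpow_neg hr.le, ← div_eq_mul_inv, le_div_iff₀ (by positivity)]
    calc (𝓕.card : ℝ) * r ^ s ≤ (A * H) ^ (d + 1) * r ^ s := by gcongr
      _ = A ^ (d + 1) * (H ^ (d + 1) * r ^ s) := by ring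
      _ ≤ A ^ (d + 1) * 4 := by gcongr
  right; right
  have hd : 2 ≤ d := by
    rcases hdr with h | h
    · exact h
    · exact absurd h hrε
  push Not at hrε
  have hεr : ε < r := by linarith
  set s1 : ℝ := s * (d + 1 / 2) / (d + 1) with hs1d
  have hs10 : 0 < s1 := by positivity
  have hs1s : s1 ≤ s := by
    rw [hs1d, div_le_iff₀ (by positivity)]
    gcongr; norm_num
  set δA : ℝ := H ^ (-((2 * (d:ℝ) + 1) / 4)) with hδA
  have hδA0 : 0 < δA := by positivity
  have hδA1 : δA ≤ 1 := by
    apply Real.rpow_le_one_of_one_le_of_nonpos hH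
    have : 0 ≤ (2 * (d:ℝ) + 1) / 4 := by positivity
    linarith
  have hδA4 : δA ^ 4 * H ^ (2 * d + 1) = 1 := by
    rw [hδA, ← Real.rpow_natCast (H ^ _) 4, ← Real.rpow_mul hH0.le, ← Real.rpow_natCast H,
      ← Real.rpow_add hH0]
    have : -((2 * (d:ℝ) + 1) / 4) * ((4:ℕ):ℝ) + ((2 * d + 1 : ℕ):ℝ) = 0 := by push_cast; ring
    rw [this, Real.rpow_zero]
  have hεs1 : ε ^ s1 = δA ^ 2 := by
    rw [hε, hδA, ← Real.rpow_mul hH0.le, ← Real.rpow_natCast (H ^ _) 2, ← Real.rpow_mul hH0.le]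
    congr 1
    rw [hs1d]; push_cast; field_simp; norm_num
  have hlarge : ((d + 1) * C1) ^ (2 * d) < H := (le_max_right _ _).trans_lt hHC
  have hrs1 : (r ^ s1)⁻¹ ≤ r ^ (-s) := by
    rw [Real.rpow_neg hr.le]
    gcongr 1
    exact Real.rpow_le_rpow_of_exponent_ge hr hr1 hs1s
  have hE3' : (2 * K + 2) * r ^ (-s) ≤ E3 * r ^ (-s) := by
    gcongr
    simp only [E3]
    have : 0 < CB * C1 ^ (d + 1) := by positivity
    nlinarith
  have hr2 : r ^ s1 * r ^ s1 = (r ^ 2) ^ s1 := by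
    rw [← Real.mul_rpow hr.le hr.le, sq]
  have hr11 : r ^ s1 ≤ 1 := Real.rpow_le_one hr.le hr1 hs10.le
  by_cases h3 : ε ≤ r ^ 2
  · -- case 3
    have hL : δA ≤ r ^ s1 := by
      apply le_of_sq_le_sq _ (by positivity)
      rw [← hεs1, sq, hr2]
      exact Real.rpow_le_rpow hε0.le h3 hs10.le
    have := group_count 𝓕 x hK0 hK (by positivity : 0 < r ^ s1) hr11 zero_le_one
      (fun 𝓖 hG F0 hF0 hdist => by
        apply sizeA hd hδA0 hδA1 hH hC1p.le hδA4 hlarge 𝓖 (y := x F0)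
        intro P hP
        have hP' := hG hP
        refine ⟨(hF P hP').1, (hF P hP').2.1, (hF P hP').2.2, ?_⟩
        have e : C1 * H = (d + 1) * 2 ^ d * (C0 * H) := by rw [hC1]; ring
        rw [e]
        apply shift_ph2 (hF P hP').2.1.le (hdist P hP) hδA0 hL hr11 (by positivity) (htc P hP')
        intro k hk
        have := interp (abs_nonneg _) (htc P hP' k hk) (pow_pos hr k) hε0 (htc' P hP' k hk)
          hs10.le (hs1s.trans hs1)
        rw [hεs1] at this
        rwa [← Real.rpow_natCast (r ^ s1), ← Real.rpow_mul hr.le, mul_comm s1, Real.rpow_mul hr.le,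
          Real.rpow_natCast])
    refine this.trans (le_trans ?_ hE3')
    rw [mul_one, div_eq_mul_inv]
    gcongr
  push Not at h3
  have hδAr : r ^ s1 ≤ δA := by
    apply le_of_sq_le_sq _ hδA0.le
    rw [← hεs1, sq, hr2]
    exact Real.rpow_le_rpow (by positivity) h3.le hs10.le
  have hεδ : ε ≤ δA ^ 2 := by
    rw [← hεs1]
    exact Real.self_le_rpow_of_le_one hε0.le hε1 (hs1s.trans hs1)
  have hphall : ∀ δ, 0 < δ → δ ≤ 1 → δA ≤ δ → ε / r ≤ δ → ∀ F0 ∈ 𝓕, ∀ P ∈ 𝓕, |x F0 - x P| ≤ δ →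
      ‖ph (x F0) δ d P‖ ≤ C1 * H := by
    intro δ hδ0 hδ1 hδ hδr F0 hF0 P hP hdist
    have e : C1 * H = (d + 1) * 2 ^ d * (C0 * H) := by rw [hC1]; ring
    rw [e]
    apply shift_ph1 (hF P hP).2.1.le hdist hδ0 le_rfl hδ1 (by positivity)
    intro k hk
    match k, hk with
    | 0, hk =>
      have := htc' P hP 0 hk
      simp only [pow_zero, mul_one] at this
      refine this.trans ?_
      gcongr
      exact hεδ.trans (by gcongr)
    | 1, hk =>
      have := htc' P hP 1 hk
      rw [pow_one, ← le_div_iff₀ hr, mul_div_assoc] at this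
      refine this.trans ?_
      simp only [Nat.add_one_sub_one, pow_one]
      gcongr
    | (k+2), hk => simpa using htc P hP _ hk
  by_cases h4 : ε / r ≤ δA
  · have := group_count 𝓕 x hK0 hK hδA0 hδA1 zero_le_one
      (fun 𝓖 hG F0 hF0 hdist => by
        apply sizeA hd hδA0 hδA1 hH hC1p.le hδA4 hlarge 𝓖 (y := x F0)
        intro P hP
        have hP' := hG hP
        exact ⟨(hF P hP').1, (hF P hP').2.1, (hF P hP').2.2,
          hphall δA hδA0 hδA1 le_rfl h4 F0 (hG hF0) P hP' (hdist P hP)⟩)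
    refine this.trans (le_trans ?_ hE3')
    rw [mul_one, div_eq_mul_inv]
    gcongr
    refine le_trans ?_ hrs1
    gcongr
  push Not at h4
  set δ := ε / r with hδ
  have hδ0 : 0 < δ := by positivity
  have hδ1 : δ ≤ 1 := by rw [hδ, div_le_one hr]; exact hεr.le
  set Bd := H ^ (d + 1) * δ ^ (1 + s) with hBd
  have hB1 : 1 ≤ Bd := by
    have e1 : δA ^ 2 ≤ δ ^ (1 + s) := by
      calc δA ^ 2 ≤ δ ^ 2 := by gcongr
        _ = δ ^ (2:ℝ) := by norm_cast
        _ ≤ δ ^ (1 + s) := Real.rpow_le_rpow_of_exponent_ge hδ0 hδ1 (by linarith)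
    have e2 : ε ^ s ≤ δA ^ 2 := by
      rw [← hεs1]
      exact Real.rpow_le_rpow_of_exponent_ge hε0 hε1 hs1s
    calc 1 = ε ^ s * H ^ (d + 1) := hεs.symm
      _ ≤ δ ^ (1 + s) * H ^ (d + 1) := by gcongr; exact e2.trans e1
      _ = Bd := by rw [hBd]; ring
  have := group_count 𝓕 x hK0 hK hδ0 hδ1 (B := (1 + CB * C1 ^ (d + 1)) * Bd) (by positivity)
    (fun 𝓖 hG F0 hF0 hdist => by
      have hpos : 0 < CB * C1 ^ (d + 1) := by positivity
      by_cases h2 : 2 ≤ 𝓖.card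
      · have := hB hd (x F0) δ (C1 * H) hδ0 hδ1 (one_le_mul_of_one_le_of_one_le hC11 hH)
          (hlow F0 (hG hF0)) 𝓖 (fun P hP => by
            have hP' := hG hP
            exact ⟨(hF P hP').1, (hF P hP').2.1, (hF P hP').2.2,
              hphall δ hδ0 hδ1 h4.le le_rfl F0 (hG hF0) P hP' (hdist P hP)⟩) h2
        refine this.trans ?_
        have e : CB * ((C1 * H) ^ (d + 1) * δ ^ (1 + s)) = (CB * C1 ^ (d + 1)) * Bd := by
          rw [hBd]; ring
        rw [e]
        gcongr
        linarith
      · have h5 : (𝓖.card : ℝ) ≤ 1 := by exact_mod_cast (by omega : 𝓖.card ≤ 1)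
        refine h5.trans (one_le_mul_of_one_le_of_one_le (by linarith) hB1))
  refine this.trans (le_of_eq ?_)
  have e1 : δ ^ (1 + s) = δ * (ε ^ s * r ^ (-s)) := by
    rw [Real.rpow_add hδ0, Real.rpow_one, hδ, Real.div_rpow hε0.le hr.le, Real.rpow_neg hr.le]
    ring
  rw [hBd, e1]
  calc _ = E3 * r ^ (-s) * (ε ^ s * H ^ (d + 1)) * (δ / δ) := by simp only [E3]; ring
    _ = _ := by rw [hεs, div_self hδ0.ne']; ring

end Bern


namespace Bern
open Polynomial

lemma local_data {d : ℕ} (hd : 1 ≤ d) {s : ℝ} (hs0 : 0 < s) (hs1 : s ≤ 1) {x : ℝ} {F : ℤ[X]}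
    (hFd : F.natDegree = d) (h0 : tc x F 0 ≠ 0)
    (h : |tc x F 0| ≤ mm x 1 F ^ (1 - ((d:ℝ) + 1) / s)) :
    ∃ l i : ℕ, l ≤ i ∧ (2:ℝ) ^ l ≤ mm x 1 F ∧ mm x 1 F ≤ 2 * 2 ^ l ∧
      (∃ z ∈ (cc F).roots, |x - z.re| ≤ (1/2 : ℝ) ^ i) ∧
      (2 ≤ d ∨ (1/2 : ℝ) ^ i ≤ 4 * ((2:ℝ) ^ l) ^ (-(((d:ℝ) + 1) / s))) ∧
      (∀ j ≤ d, |tc x F j| ≤ (2 * 4 ^ d) * 2 ^ l) ∧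
      (∀ j ≤ d, |tc x F j| * ((1/2 : ℝ) ^ i) ^ j ≤
        (2 * 4 ^ d) * 2 ^ l * ((2:ℝ) ^ l) ^ (-(((d:ℝ) + 1) / s))) := by
  have hF0 : F ≠ 0 := by rintro rfl; simp at hFd; omega
  obtain ⟨β, hβ⟩ := exists_roots F
  have hev : |tc x F 0| = |(F.leadingCoeff:ℝ)| * ∏ i, ‖(x:ℂ) - β i‖ := by
    have h1 := tc_taylor_cc x F 0
    rw [taylor_coeff_zero, hβ] at h1
    have h2 := congrArg (fun z => ‖z‖) h1
    simp only [eval_mul, eval_C, eval_prod, eval_sub, eval_X, norm_mul, norm_prod,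
      Complex.norm_real, Complex.norm_intCast, Real.norm_eq_abs] at h2
    exact h2.symm
  have : Nonempty (Fin F.natDegree) := ⟨⟨0, by omega⟩⟩
  obtain ⟨i0, -, hmin⟩ := Finset.exists_min_image Finset.univ (fun i => ‖(x:ℂ) - β i‖)
    Finset.univ_nonempty
  set ρ := ‖(x:ℂ) - β i0‖ with hρ
  have hlc := abs_lc_ge hF0
  have hρ0 : 0 < ρ := by
    rcases (norm_nonneg ((x:ℂ) - β i0)).eq_or_lt with h1 | h1
    · exfalso
      have : ∏ i, ‖(x:ℂ) - β i‖ = 0 := Finset.prod_eq_zero (Finset.mem_univ i0) h1.symm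
      rw [this, mul_zero] at hev
      exact h0 (abs_eq_zero.1 hev)
    · exact h1
  have hmmρ : mm x ρ F = |tc x F 0| := by
    rw [mm_eq hβ x hρ0, hev]
    congr 1
    apply Finset.prod_congr rfl
    intro i _
    exact max_eq_right (hmin i (Finset.mem_univ i))
  have hm1 : 1 ≤ mm x 1 F := one_le_mm x hF0
  set m := mm x 1 F with hm
  have hm0 : 0 < m := by linarith
  have hdd : (0:ℝ) ≤ d := Nat.cast_nonneg d
  have hv : (d:ℝ) + 1 ≤ ((d:ℝ) + 1) / s := by
    rw [le_div_iff₀ hs0]; nlinarith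
  have hρd : ρ ^ d ≤ |tc x F 0| := by
    rw [hev]
    calc ρ ^ d = ∏ i : Fin F.natDegree, ρ := by simp [hFd]
      _ ≤ ∏ i, ‖(x:ℂ) - β i‖ := Finset.prod_le_prod (fun _ _ => hρ0.le) (fun i _ => hmin i (Finset.mem_univ i))
      _ = 1 * ∏ i, ‖(x:ℂ) - β i‖ := (one_mul _).symm
      _ ≤ _ := by gcongr
  have hρm : ρ ≤ m⁻¹ := by
    have : ρ ^ d ≤ (m⁻¹) ^ d := by
      refine (hρd.trans h).trans ?_
      rw [inv_pow, ← Real.rpow_natCast, ← Real.rpow_neg hm0.le]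
      apply Real.rpow_le_rpow_of_exponent_le hm1
      linarith
    exact le_of_pow_le_pow_left₀ (by omega) (by positivity) this
  have hρ1 : ρ ≤ 1 := hρm.trans (inv_le_one_of_one_le₀ hm1)
  obtain ⟨l, hl1, hl2⟩ := exists_nat_pow_near hm1 (one_lt_two : (1:ℝ) < 2)
  obtain ⟨i, hi1, hi2⟩ := exists_nat_pow_near_of_lt_one hρ0 hρ1
    (by norm_num : (0:ℝ) < 1/2) (by norm_num)
  have h2l : (0:ℝ) < 2 ^ l := by positivity
  have h2l1 : (1:ℝ) ≤ 2 ^ l := one_le_pow₀ (by norm_num)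
  have hr : (1/2:ℝ) ^ i < 2 * ρ := by rw [pow_succ] at hi1; linarith
  have hε : |tc x F 0| ≤ 2 ^ l * ((2:ℝ) ^ l) ^ (-(((d:ℝ) + 1) / s)) := by
    refine h.trans ?_
    have e : (2:ℝ) ^ l * ((2:ℝ) ^ l) ^ (-(((d:ℝ) + 1) / s)) = (2 ^ l) ^ (1 - ((d:ℝ) + 1) / s) := by
      rw [sub_eq_add_neg, Real.rpow_add h2l, Real.rpow_one]
    rw [e]
    exact Real.rpow_le_rpow_of_nonpos h2l hl1 (by linarith)
  refine ⟨l, i, ?_, hl1, by rw [pow_succ] at hl2; linarith, ⟨β i0, ?_, ?_⟩, ?_, ?_, ?_⟩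
  · have h1 : (1/2:ℝ) ^ (i + 1) < (1/2) ^ l := by
      refine hi1.trans_le (hρm.trans ?_)
      rw [one_div, inv_pow]
      gcongr
    have := (pow_lt_pow_iff_right_of_lt_one₀ (by norm_num : (0:ℝ) < 1/2) (by norm_num)).1 h1
    omega
  · rw [mem_roots (cc_ne hF0), IsRoot, hβ, eval_mul, eval_prod]
    rw [Finset.prod_eq_zero (Finset.mem_univ i0) (by simp), mul_zero]
  · refine le_trans ?_ hi2
    have := Complex.abs_re_le_norm ((x:ℂ) - β i0)
    simpa using this
  · rcases Nat.lt_or_ge d 2 with h2 | h2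
    · right
      have hd1 : d = 1 := by omega
      subst hd1
      have hu : ∀ i, i = i0 := by
        intro i; apply Fin.ext; have := i.2; have := i0.2; omega
      have e1 : |tc x F 0| = |(F.leadingCoeff:ℝ)| * ρ := by
        rw [hev]; congr 1
        rw [Finset.prod_eq_single i0 (fun b _ hb => absurd (hu b) hb) (by simp)]
      have e2 : m = |(F.leadingCoeff:ℝ)| := by
        rw [hm, mm_eq hβ x one_pos, Finset.prod_eq_single i0 (fun b _ hb => absurd (hu b) hb) (by simp),
          max_eq_left hρ1, mul_one]
      rw [e1, ← e2] at hε
      have h5 : 2 ^ l * ρ ≤ 2 ^ l * ((2:ℝ) ^ l) ^ (-((((1:ℕ):ℝ) + 1) / s)) := le_trans (by gcongr) hε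
      have h6 := le_of_mul_le_mul_left h5 h2l
      linarith
    · left; exact h2
  · intro j hj
    have := tc_le x one_pos F j d hFd.le
    rw [one_pow, mul_one] at this
    have h4 : (2:ℝ) ^ d ≤ 4 ^ d := by gcongr; norm_num
    calc _ ≤ 2 ^ d * mm x 1 F := this
      _ ≤ 4 ^ d * (2 * 2 ^ l) := by
        gcongr
        rw [pow_succ] at hl2; linarith
      _ = _ := by ring
  · intro j hj
    have h1 := tc_le x hρ0 F j d hFd.le
    rw [hmmρ] at h1
    have h4 : (2:ℝ) ^ j ≤ 2 ^ d := pow_le_pow_right₀ (by norm_num) hj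
    calc |tc x F j| * ((1/2:ℝ) ^ i) ^ j ≤ |tc x F j| * (2 * ρ) ^ j := by gcongr
      _ = 2 ^ j * (|tc x F j| * ρ ^ j) := by rw [mul_pow]; ring
      _ ≤ 2 ^ d * (2 ^ d * (2 ^ l * ((2:ℝ) ^ l) ^ (-(((d:ℝ) + 1) / s)))) := by
        exact mul_le_mul h4 (h1.trans (by gcongr)) (by positivity) (by positivity)
      _ = 4 ^ d * 2 ^ l * ((2:ℝ) ^ l) ^ (-(((d:ℝ) + 1) / s)) := by
        rw [show (4:ℝ) = 2 * 2 by norm_num, mul_pow]; ring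
      _ ≤ _ := by
        gcongr
        have : (0:ℝ) < 4 ^ d := by positivity
        linarith

lemma poly_exp {η : ℝ} (hη : 0 < η) : ∃ C : ℝ, 0 < C ∧ ∀ i : ℕ, (i:ℝ) + 1 ≤ C * (2:ℝ) ^ ((i:ℝ) * η) := by
  have hl : 0 < Real.log 2 := Real.log_pos (by norm_num)
  have ha : 0 < η * Real.log 2 := by positivity
  refine ⟨1 + 1 / (η * Real.log 2), by positivity, fun i => ?_⟩
  have h1 : (i:ℝ) * (η * Real.log 2) + 1 ≤ (2:ℝ) ^ ((i:ℝ) * η) := by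
    rw [Real.rpow_def_of_pos (by norm_num)]
    have := Real.add_one_le_exp (Real.log 2 * (i * η))
    linarith
  have hi : (0:ℝ) ≤ i := Nat.cast_nonneg i
  calc (i:ℝ) + 1 ≤ (1 + 1 / (η * Real.log 2)) * (i * (η * Real.log 2) + 1) := by
        have e : (1 + 1 / (η * Real.log 2)) * (i * (η * Real.log 2) + 1) =
          i + 1 + (i * (η * Real.log 2) + 1 / (η * Real.log 2)) := by field_simp; ring
        rw [e]
        have : 0 ≤ i * (η * Real.log 2) + 1 / (η * Real.log 2) := by positivity
        linarith
    _ ≤ _ := by gcongr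

set_option maxHeartbeats 1000000 in
theorem dim_core {d : ℕ} (hd : 1 ≤ d) {s : ℝ} (hs : 1/2 ≤ s) (hs1 : s ≤ 1) {c : ℝ} (hc : 0 < c)
    {K : ℝ} (hK0 : 0 ≤ K) (A : Set ℝ) (hK : ∀ x ∈ A, |x| ≤ K)
    (htr : ∀ x ∈ A, ∀ F : ℤ[X], F ≠ 0 → tc x F 0 ≠ 0)
    (hlow : ∀ x ∈ A, ∀ G : ℤ[X], Irreducible G → 0 < G.natDegree → G.natDegree < d →
        c * mm x 1 G ^ (1 - ((G.natDegree : ℝ) + 1) / s) ≤ |tc x G 0|)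
    (hinf : ∀ x ∈ A, {F : ℤ[X] | (Irreducible F ∧ F.natDegree = d ∧ 0 < F.leadingCoeff) ∧
      |tc x F 0| ≤ mm x 1 F ^ (1 - ((d : ℝ) + 1) / s)}.Infinite) :
    dimH A ≤ ENNReal.ofReal s := by
  classical
  have hs0 : 0 < s := by linarith
  suffices h : ∀ t : ℝ, s < t → dimH A ≤ ENNReal.ofReal t by
    apply le_of_forall_gt_imp_ge_of_dense
    intro b hb
    by_cases hbt : b = ⊤
    · rw [hbt]; exact le_top
    · rw [← ENNReal.ofReal_toReal hbt]
      apply h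
      rwa [← ENNReal.ofReal_lt_iff_lt_toReal hs0.le hbt]
  intro t hst
  obtain ⟨Cst, hCst, hcount⟩ := count_class d s hs hs1 c hc K hK0 (2 * 4 ^ d) (by
    have : (1:ℝ) ≤ 4 ^ d := one_le_pow₀ (by norm_num)
    linarith)
  obtain ⟨C3, hC3, hpe⟩ := poly_exp (sub_pos.2 hst)
  set Q : ℝ → ℤ[X] → ℕ → ℕ → Prop := fun x F l i =>
    (Irreducible F ∧ F.natDegree = d ∧ 0 < F.leadingCoeff) ∧ mm x 1 F ≤ 2 * 2 ^ l ∧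
      (2 ≤ d ∨ (1/2 : ℝ) ^ i ≤ 4 * ((2:ℝ) ^ l) ^ (-(((d:ℝ) + 1) / s))) ∧
      (∀ j ≤ d, |tc x F j| ≤ (2 * 4 ^ d) * 2 ^ l) ∧
      (∀ j ≤ d, |tc x F j| * ((1/2 : ℝ) ^ i) ^ j ≤
        (2 * 4 ^ d) * 2 ^ l * ((2:ℝ) ^ l) ^ (-(((d:ℝ) + 1) / s))) with hQ
  have hfin : ∀ l i, {F : ℤ[X] | ∃ x ∈ A, Q x F l i}.Finite := by
    intro l i
    refine (finite_mm 0 d ((1 + K) ^ d * (2 * 2 ^ l))).subset ?_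
    rintro F ⟨x, hx, hq⟩
    refine ⟨hq.1.2.1.le, (mm_compare 0 x K (by simpa using hK x hx) F).trans ?_⟩
    rw [hq.1.2.1]
    gcongr
    exact hq.2.1
  set 𝓕 : ℕ → ℕ → Finset ℤ[X] := fun l i => (hfin l i).toFinset with h𝓕
  have hmem : ∀ {l i F}, F ∈ 𝓕 l i ↔ ∃ x ∈ A, Q x F l i := by
    intro l i F; simp [h𝓕]
  have hcard : ∀ l i, ((𝓕 l i).card : ℝ) ≤ Cst * ((1/2:ℝ) ^ i) ^ (-s) := by
    intro l i
    choose! x hxA hx using fun F (hF : F ∈ 𝓕 l i) => hmem.1 hF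
    rcases (𝓕 l i).eq_empty_or_nonempty with he | ⟨F0, hF0⟩
    · rw [he]; simp; positivity
    have h4 : (2:ℝ) ≤ 2 * 4 ^ d := by
      have : (1:ℝ) ≤ 4 ^ d := one_le_pow₀ (by norm_num)
      linarith
    exact hcount (2 ^ l) _ ((1/2) ^ i) (one_le_pow₀ (by norm_num)) rfl (by positivity)
      (pow_le_one₀ (by norm_num) (by norm_num)) (hx F0 hF0).2.2.1 (𝓕 l i) x
      (fun F hF => (hx F hF).1) (fun F hF => hK _ (hxA F hF))
      (fun F hF => (hx F hF).2.1.trans (by gcongr)) (fun F hF => (hx F hF).2.2.2.1)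
      (fun F hF => (hx F hF).2.2.2.2) (fun F hF => hlow _ (hxA F hF))
  set T : ℕ → Finset ℝ := fun i => (Finset.range (i + 1)).biUnion fun l => (𝓕 l i).biUnion fun F =>
    (cc F).roots.toFinset.image Complex.re with hT
  apply limsup_cover A t (by linarith) (Cst * d * C3) T
  · intro i
    have h1 : ((T i).card : ℝ) ≤ ∑ l ∈ Finset.range (i + 1), Cst * ((1/2:ℝ) ^ i) ^ (-s) * d := by
      have h2 : (T i).card ≤ ∑ l ∈ Finset.range (i + 1), (𝓕 l i).card * d := by
        refine Finset.card_biUnion_le.trans (Finset.sum_le_sum fun l _ => ?_)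
        refine Finset.card_biUnion_le.trans ?_
        refine (Finset.sum_le_card_nsmul _ _ d fun F hF => ?_).trans (by simp)
        refine Finset.card_image_le.trans ((Multiset.toFinset_card_le _).trans ?_)
        obtain ⟨x, -, hq⟩ := hmem.1 hF
        refine (card_roots' _).trans ?_
        rw [cc_natDegree, hq.1.2.1]
      calc ((T i).card : ℝ) ≤ ((∑ l ∈ Finset.range (i + 1), (𝓕 l i).card * d : ℕ) : ℝ) := by
            exact_mod_cast h2
        _ = ∑ l ∈ Finset.range (i + 1), ((𝓕 l i).card : ℝ) * d := by push_cast; rfl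
        _ ≤ _ := by
          apply Finset.sum_le_sum
          intro l _
          gcongr
          exact hcard l i
    refine h1.trans ?_
    rw [Finset.sum_const, Finset.card_range, nsmul_eq_mul]
    have e : ((1/2:ℝ) ^ i) ^ (-s) = (2:ℝ) ^ ((i:ℝ) * s) := by
      rw [one_div, inv_pow, Real.inv_rpow (by positivity), Real.rpow_neg (by positivity), inv_inv,
        ← Real.rpow_natCast, ← Real.rpow_mul (by norm_num)]
    rw [e]
    push_cast
    calc ((i:ℝ) + 1) * (Cst * 2 ^ ((i:ℝ) * s) * d) ≤ (C3 * (2:ℝ) ^ ((i:ℝ) * (t - s))) * (Cst * 2 ^ ((i:ℝ) * s) * d) := by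
          gcongr; exact hpe i
      _ = Cst * d * C3 * (2 ^ ((i:ℝ) * (t - s)) * 2 ^ ((i:ℝ) * s)) := by ring
      _ = _ := by rw [← Real.rpow_add (by norm_num)]; congr 2; ring
  · intro x hx
    rw [Filter.frequently_atTop]
    intro N
    obtain ⟨F, hF, hFN⟩ := ((hinf x hx).sdiff (finite_mm x d (2 * 2 ^ N))).nonempty
    obtain ⟨l, i, hli, hl1, hl2, ⟨z, hz, hxz⟩, h1, h2, h3⟩ := local_data hd hs0 hs1 hF.1.2.1
      (htr x hx F hF.1.1.ne_zero) hF.2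
    refine ⟨i, ?_, z.re, ?_, ?_⟩
    · by_contra hlt
      apply hFN
      refine ⟨hF.1.2.1.le, hl2.trans ?_⟩
      have : (2:ℝ) ^ l ≤ 2 ^ N := pow_le_pow_right₀ (by norm_num) (by omega)
      linarith
    · simp only [hT, Finset.mem_biUnion, Finset.mem_range, Finset.mem_image, Multiset.mem_toFinset]
      exact ⟨l, by omega, F, hmem.2 ⟨x, hx, hF.1, hl2, h1, h2, h3⟩, z, hz, rfl⟩
    · refine hxz.trans (le_of_eq ?_)
      rw [Real.rpow_neg (by norm_num), Real.rpow_natCast, one_div, inv_pow]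

end Bern


namespace Bern
open Polynomial

lemma tc_neg (y : ℝ) (F : ℤ[X]) (j : ℕ) : tc y (-F) j = - tc y F j := by
  simp [tc]

lemma mm_neg (y ρ : ℝ) (F : ℤ[X]) : mm y ρ (-F) = mm y ρ F := by
  have : -F = C (-1) * F := by simp
  rw [this, mm_mul, mm_C]; simp

/-- exponent-`e` good approximations of degree `f`. -/
def apx (x : ℝ) (f : ℕ) (e : ℝ) : Set ℤ[X] :=
  {F : ℤ[X] | (Irreducible F ∧ F.natDegree = f ∧ 0 < F.leadingCoeff) ∧ |tc x F 0| ≤ mm x 1 F ^ e}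

lemma low_const {x : ℝ} (htr : ∀ F : ℤ[X], F ≠ 0 → tc x F 0 ≠ 0) (D : ℕ) (e : ℕ → ℝ)
    (hfin : ∀ f, 0 < f → f < D → (apx x f (e f)).Finite) :
    ∃ c : ℝ, 0 < c ∧ c ≤ 1 ∧ ∀ G : ℤ[X], Irreducible G → 0 < G.natDegree → G.natDegree < D →
      c * mm x 1 G ^ (e G.natDegree) ≤ |tc x G 0| := by
  classical
  set Z : Set ℤ[X] := ⋃ f ∈ Finset.Ioo 0 D, apx x f (e f) with hZ
  have hZf : Z.Finite := by
    apply Set.Finite.biUnion (Finset.finite_toSet _)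
    intro f hf
    have := Finset.mem_Ioo.1 (Finset.mem_coe.1 hf)
    exact hfin f this.1 this.2
  set g : ℤ[X] → ℝ := fun G => mm x 1 G ^ (e G.natDegree) / |tc x G 0| with hg
  have hg0 : ∀ G, 0 ≤ g G := fun G => by
    have := mm_nonneg x 1 G
    positivity
  set Sg := ∑ G ∈ hZf.toFinset, g G
  have hSg : 0 ≤ Sg := Finset.sum_nonneg fun G _ => hg0 G
  have hc0 : 0 < (1 + Sg)⁻¹ := by positivity
  have hc1 : (1 + Sg)⁻¹ ≤ 1 := inv_le_one_of_one_le₀ (by linarith)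
  refine ⟨(1 + Sg)⁻¹, hc0, hc1, ?_⟩
  have main : ∀ G : ℤ[X], Irreducible G → 0 < G.natDegree → G.natDegree < D → 0 < G.leadingCoeff →
      (1 + Sg)⁻¹ * mm x 1 G ^ (e G.natDegree) ≤ |tc x G 0| := by
    intro G hG hG1 hG2 hlc
    have hpos : 0 < mm x 1 G ^ (e G.natDegree) := Real.rpow_pos_of_pos (mm_pos x one_pos hG.ne_zero) _
    have htp : 0 < |tc x G 0| := abs_pos.2 (htr G hG.ne_zero)
    by_cases hGZ : |tc x G 0| ≤ mm x 1 G ^ (e G.natDegree)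
    · have hmem : G ∈ hZf.toFinset := by
        rw [Set.Finite.mem_toFinset, hZ]
        exact Set.mem_biUnion (Finset.mem_coe.2 (Finset.mem_Ioo.2 ⟨hG1, hG2⟩)) ⟨⟨hG, rfl, hlc⟩, hGZ⟩
      have h1 : g G ≤ Sg := Finset.single_le_sum (f := g) (fun G _ => hg0 G) hmem
      rw [inv_mul_le_iff₀ (by positivity), ← div_le_iff₀ htp]
      change g G ≤ _
      linarith
    · push Not at hGZ
      calc _ ≤ 1 * mm x 1 G ^ (e G.natDegree) := by gcongr
        _ ≤ _ := by rw [one_mul]; exact hGZ.le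
  intro G hG hG1 hG2
  rcases lt_or_ge 0 G.leadingCoeff with h | h
  · exact main G hG hG1 hG2 h
  · have h' : 0 < (-G).leadingCoeff := by
      rw [leadingCoeff_neg]
      have := leadingCoeff_ne_zero.2 hG.ne_zero
      omega
    have := main (-G) ((Associated.refl G).neg_right.irreducible hG) (by simpa using hG1) (by simpa using hG2) h'
    rwa [natDegree_neg, mm_neg, tc_neg, abs_neg] at this

lemma alg_countable : {x : ℝ | ∃ F : ℤ[X], F ≠ 0 ∧ tc x F 0 = 0}.Countable := by
  refine (Algebraic.countable ℤ ℝ).mono ?_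
  rintro x ⟨F, hF, h⟩
  refine ⟨F, hF, ?_⟩
  rw [tc_zero, eval_map] at h
  exact h

/-- approximable points -/
def BS (K s : ℝ) (d : ℕ) : Set ℝ :=
  {x : ℝ | |x| ≤ K ∧ (apx x d (1 - ((d : ℝ) + 1) / s)).Infinite}

theorem dimBS {s : ℝ} (hs : 1/2 ≤ s) (hs1 : s ≤ 1) {K : ℝ} (hK : 0 ≤ K) :
    ∀ d : ℕ, 1 ≤ d → dimH (BS K s d) ≤ ENNReal.ofReal s := by
  intro d
  induction d using Nat.strong_induction_on with
  | _ d ih =>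
  intro hd
  set Alg := {x : ℝ | ∃ F : ℤ[X], F ≠ 0 ∧ tc x F 0 = 0} with hAlg
  set An : ℕ → Set ℝ := fun N => {x ∈ BS K s d | x ∉ Alg ∧ ∀ G : ℤ[X], Irreducible G →
    0 < G.natDegree → G.natDegree < d →
        (1 / ((N:ℝ) + 1)) * mm x 1 G ^ (1 - ((G.natDegree : ℝ) + 1) / s) ≤ |tc x G 0|} with hAn
  have hsub : BS K s d ⊆ Alg ∪ ((⋃ f ∈ Finset.Ioo 0 d, BS K s f) ∪ ⋃ N, An N) := by
    intro x hx
    by_cases h1 : x ∈ Alg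
    · exact Or.inl h1
    right
    by_cases h2 : x ∈ (⋃ f ∈ Finset.Ioo 0 d, BS K s f)
    · exact Or.inl h2
    right
    have htr : ∀ F : ℤ[X], F ≠ 0 → tc x F 0 ≠ 0 := fun F hF h => h1 ⟨F, hF, h⟩
    obtain ⟨c, hc, -, hlow⟩ := low_const htr d (fun f => 1 - ((f:ℝ) + 1) / s) (by
      intro f hf hfd
      by_contra hinf
      exact h2 (Set.mem_biUnion (Finset.mem_coe.2 (Finset.mem_Ioo.2 ⟨hf, hfd⟩)) ⟨hx.1, hinf⟩))
    obtain ⟨N, hN⟩ := exists_nat_one_div_lt hc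
    refine Set.mem_iUnion.2 ⟨N, hx, h1, fun G hG hG1 hG2 => le_trans ?_ (hlow G hG hG1 hG2)⟩
    have := mm_nonneg x 1 G
    gcongr
  refine (dimH_mono hsub).trans ?_
  rw [dimH_union, dimH_union, dimH_countable alg_countable]
  refine max_le (by simp) (max_le ?_ ((dimH_iUnion An).le.trans (iSup_le fun N => ?_)))
  · refine (dimH_bUnion (Finset.countable_toSet (Finset.Ioo 0 d)) (BS K s)).le.trans ?_
    refine iSup₂_le fun f hf => ?_
    have := Finset.mem_Ioo.1 (Finset.mem_coe.1 hf)
    exact ih f this.2 this.1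
  · refine dim_core hd hs hs1 (c := 1 / ((N:ℝ) + 1)) (by positivity) hK (An N) (fun x hx => hx.1.1)
      (fun x hx F hF h => hx.2.1 ⟨F, hF, h⟩) (fun x hx => hx.2.2) (fun x hx => hx.1.2)

end Bern


namespace Bern
open Polynomial

open Matrix in
lemma card_quot {ι : Type*} [Fintype ι] [DecidableEq ι] (A : Matrix ι ι ℤ) (hA : A.det ≠ 0) :
    Nat.card ((ι → ℤ) ⧸ LinearMap.range A.mulVecLin) = A.det.natAbs := by
  have hinj : Function.Injective A.mulVecLin := by
    intro u v h
    rw [← sub_eq_zero]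
    apply Matrix.eq_zero_of_mulVec_eq_zero hA
    rw [Matrix.mulVec_sub, sub_eq_zero]
    exact h
  have := Submodule.natAbs_det_equiv (LinearMap.range A.mulVecLin) (LinearEquiv.ofInjective _ hinj)
  refine this.symm.trans ?_
  rw [← LinearMap.det_toLin' A]
  congr 2

open Matrix in
lemma siegel {ι κ : Type*} [Fintype ι] [DecidableEq ι] [Fintype κ] [DecidableEq κ]
    (M : Matrix ι κ ℤ) (S : ι → κ) (hD : (M.submatrix id S).det ≠ 0)
    (hmax : ∀ S' : ι → κ, |(M.submatrix id S').det| ≤ |(M.submatrix id S).det|) (T : ℕ)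
    (hT : (M.submatrix id S).det.natAbs < (T + 1) ^ (Fintype.card κ - Fintype.card ι)) :
    ∃ R : κ → ℤ, R ≠ 0 ∧ M *ᵥ R = 0 ∧ ∀ j, |R j| ≤ Fintype.card κ * T + T := by
  classical
  set A := M.submatrix id S with hA
  have hSinj : Function.Injective S := by
    intro i j hij
    by_contra hne
    apply hD
    apply Matrix.det_zero_of_column_eq hne
    intro k
    simp [hA, hij]
  set Nn := LinearMap.range A.mulVecLin with hNn
  have hcard : Fintype.card {j : κ // j ∉ Set.range S} = Fintype.card κ - Fintype.card ι := by
    rw [Fintype.card_subtype_compl, Fintype.card_congr (Equiv.ofInjective S hSinj)]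
  have hq := card_quot A hD
  have : Finite ((ι → ℤ) ⧸ Nn) := by
    apply Nat.finite_of_card_ne_zero
    rw [hq]; simpa using hD
  have := Fintype.ofFinite ((ι → ℤ) ⧸ Nn)
  set y : ({j : κ // j ∉ Set.range S} → Fin (T + 1)) → (ι → ℤ) := fun r i => ∑ j : {j : κ // j ∉ Set.range S}, ((r j : ℕ) : ℤ) * M i j with hy
  obtain ⟨r, r', hne, heq⟩ := Fintype.exists_ne_map_eq_of_card_lt (fun r => (Submodule.Quotient.mk (y r) : (ι → ℤ) ⧸ Nn)) (by
    rw [← Nat.card_eq_fintype_card, hq, Fintype.card_fun, Fintype.card_fin, hcard]; exact hT)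
  rw [Submodule.Quotient.eq] at heq
  obtain ⟨z, hz⟩ := heq
  set w : {j : κ // j ∉ Set.range S} → ℤ := fun j => (r j : ℕ) - (r' j : ℕ) with hw
  have hw1 : ∀ j, |w j| ≤ T := by
    intro j
    have h1 := (r j).2
    have h2 := (r' j).2
    simp only [hw, abs_le]
    omega
  have hz' : A *ᵥ z = ∑ j : {j : κ // j ∉ Set.range S}, w j • (fun i => M i j) := by
    rw [← Matrix.mulVecLin_apply, hz]
    ext i
    simp only [hy, Pi.sub_apply, Finset.sum_apply, Pi.smul_apply, smul_eq_mul, hw]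
    rw [← Finset.sum_sub_distrib]
    exact Finset.sum_congr rfl fun j _ => by ring
  have hzb : ∀ i, |z i| ≤ Fintype.card κ * T := by
    intro i
    have h1 : A.det * z i = ∑ j : {j : κ // j ∉ Set.range S}, w j * (M.submatrix id (Function.update S i j)).det := by
      have h2 : A.cramer (A *ᵥ z) = A.det • z := by
        rw [Matrix.cramer_eq_adjugate_mulVec, Matrix.mulVec_mulVec, Matrix.adjugate_mul, Matrix.smul_mulVec, Matrix.one_mulVec]
      have h3 := congrFun h2 i
      rw [Pi.smul_apply, smul_eq_mul] at h3
      rw [← h3, hz', map_sum, Finset.sum_apply]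
      refine Finset.sum_congr rfl fun j _ => ?_
      rw [map_smul, Pi.smul_apply, smul_eq_mul, Matrix.cramer_apply]
      congr 2
      ext a b
      simp only [hA, Matrix.updateCol_apply, Matrix.submatrix_apply, id, Function.update_apply]
      split_ifs <;> rfl
    have h4 : |A.det| * |z i| ≤ |A.det| * (Fintype.card κ * T) := by
      rw [← abs_mul, h1]
      refine (Finset.abs_sum_le_sum_abs _ _).trans ?_
      calc _ ≤ ∑ j : {j : κ // j ∉ Set.range S}, (T:ℤ) * |A.det| := by
            apply Finset.sum_le_sum
            intro j _
            rw [abs_mul]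
            exact mul_le_mul (hw1 j) (hmax _) (abs_nonneg _) (by positivity)
        _ = Fintype.card {j : κ // j ∉ Set.range S} * (T * |A.det|) := by simp
        _ ≤ Fintype.card κ * (T * |A.det|) := by
            gcongr
            rw [hcard]; omega
        _ = _ := by ring
    exact le_of_mul_le_mul_left h4 (abs_pos.2 hD)
  set R : κ → ℤ := fun j => if h : j ∈ Set.range S then - z h.choose else w ⟨j, h⟩ with hR
  have hRS : ∀ i, R (S i) = - z i := by
    intro i
    have h : S i ∈ Set.range S := ⟨i, rfl⟩
    simp only [hR, dif_pos h]
    rw [hSinj h.choose_spec]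
  have hRw : ∀ j : {j : κ // j ∉ Set.range S}, R j = w j := by
    intro j
    exact dif_neg j.2
  refine ⟨R, ?_, ?_, ?_⟩
  · intro h0
    apply hne
    ext j
    have := hRw j
    rw [h0] at this
    simp only [hw, Pi.zero_apply] at this
    omega
  · ext i
    have key := Fintype.sum_subtype_add_sum_subtype (fun j => j ∈ Set.range S) (fun j => M i j * R j)
    have e1 : ∑ j : {j // j ∈ Set.range S}, M i j * R j = - (A *ᵥ z) i := by
      rw [← Equiv.sum_comp (Equiv.ofInjective S hSinj)]
      simp [hRS, Matrix.mulVec, dotProduct, hA]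
    have e2 : ∑ j : {j : κ // j ∉ Set.range S}, M i j * R j = (A *ᵥ z) i := by
      rw [hz']
      simp only [Finset.sum_apply, Pi.smul_apply, smul_eq_mul]
      exact Finset.sum_congr rfl fun j _ => by rw [hRw, mul_comm]
    have e3 : (M *ᵥ R) i = ∑ j, M i j * R j := rfl
    rw [e3, ← key]
    refine Eq.trans (congrArg₂ (· + ·) (Eq.trans ?_ e1) (Eq.trans ?_ e2)) ?_
    · congr!
    · congr!
    · simp
  · intro j
    by_cases h : j ∈ Set.range S
    · obtain ⟨i, rfl⟩ := h
      rw [hRS, abs_neg]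
      have := hzb i
      omega
    · have h1 := hRw ⟨j, h⟩
      have h2 := hw1 ⟨j, h⟩
      simp only at h1
      rw [h1]
      have : (0:ℤ) ≤ Fintype.card κ * T := by positivity
      omega

open Matrix in
lemma exists_minor {a b : ℕ} (M : Matrix (Fin a) (Fin b) ℚ) (h : LinearIndependent ℚ M.row) :
    ∃ S : Fin a → Fin b, (M.submatrix id S).det ≠ 0 := by
  have hr := h.rank_matrix
  rw [Matrix.rank_eq_finrank_span_cols, Fintype.card_fin] at hr
  obtain ⟨f, hf, -, hli⟩ := Submodule.exists_fun_fin_finrank_span_eq ℚ (Set.range M.col)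
  choose g hg using hf
  refine ⟨fun i => g (Fin.cast hr.symm i), ?_⟩
  have h1 : LinearIndependent ℚ (M.submatrix id (fun i => g (Fin.cast hr.symm i))).col := by
    have h2 := hli.comp (Fin.cast hr.symm) (Fin.cast_injective _)
    have h3 : (M.submatrix id (fun i => g (Fin.cast hr.symm i))).col = f ∘ Fin.cast hr.symm := by
      ext i j
      simp [← hg]
    rw [h3]
    exact h2
  rw [Matrix.linearIndependent_cols_iff_isUnit, Matrix.isUnit_iff_isUnit_det] at h1
  exact h1.ne_zero

end Bern


namespace Bern
open Polynomial

open Matrix in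
lemma hankel_li {n h k : ℕ} (hh : 2 * h ≤ n) (hk : k ≤ h) (q : Fin (n + 1) → ℤ)
    (hr : hankelRank n h q = h + 1) :
    LinearIndependent ℚ (Matrix.of fun (i : Fin (k + 1)) (j : Fin (n - k + 1)) =>
    ((q ⟨(i.1 + j.1) % (n + 1), Nat.mod_lt _ n.succ_pos⟩ : ℤ) : ℚ)).row := by
  have h1 : LinearIndependent ℚ (Matrix.of fun (i : Fin (h + 1)) (j : Fin (n - h + 1)) =>
    ((q ⟨(i.1 + j.1) % (n + 1), Nat.mod_lt _ n.succ_pos⟩ : ℤ) : ℚ)).row := by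
    rw [linearIndependent_iff_card_eq_finrank_span, Set.finrank]
    rw [hankelRank, Matrix.rank_eq_finrank_span_row] at hr
    rw [hr]; simp
  have h2 := h1.comp (Fin.castLE (by omega : k + 1 ≤ h + 1)) (Fin.castLE_injective _)
  have hle : n - h + 1 ≤ n - k + 1 := by omega
  refine LinearIndependent.of_comp (LinearMap.funLeft ℚ ℚ (Fin.castLE hle)) ?_
  exact h2

lemma det_bound {k : ℕ} (M : Matrix (Fin (k + 1)) (Fin (k + 1)) ℝ) (a b : ℝ)
    (h0 : ∀ j, |M 0 j| ≤ a) (h1 : ∀ i : Fin k, ∀ j, |M i.succ j| ≤ b) :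
    |M.det| ≤ (k + 1).factorial * (a * b ^ k) := by
  rw [← Matrix.det_transpose, Matrix.det_apply]
  refine (Finset.abs_sum_le_sum_abs _ _).trans ?_
  have : ∀ σ : Equiv.Perm (Fin (k+1)), |Equiv.Perm.sign σ • ∏ i, M.transpose (σ i) i| ≤ a * b ^ k := by
    intro σ
    have e : |Equiv.Perm.sign σ • ∏ i, M.transpose (σ i) i| = ∏ i, |M i (σ i)| := by
      rw [← Finset.abs_prod]
      rcases Int.units_eq_one_or (Equiv.Perm.sign σ) with h | h <;> simp [h, Matrix.transpose_apply]
    rw [e, Fin.prod_univ_succ]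
    have hb : ∏ i : Fin k, |M i.succ (σ i.succ)| ≤ ∏ i : Fin k, b :=
      Finset.prod_le_prod (fun _ _ => abs_nonneg _) (fun i _ => h1 i _)
    rw [Finset.prod_const, Finset.card_univ, Fintype.card_fin] at hb
    exact mul_le_mul (h0 _) hb (Finset.prod_nonneg fun _ _ => abs_nonneg _) ((abs_nonneg _).trans (h0 0))
  refine (Finset.sum_le_sum fun σ _ => this σ).trans ?_
  simp [Fintype.card_perm]

lemma hankel_det {k : ℕ} (x a b : ℝ) (w : ℕ → ℝ) (s : Fin (k + 1) → ℕ)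
    (h0 : ∀ j, |w (s j)| ≤ a) (h1 : ∀ i : Fin k, ∀ j, |w (i + 1 + s j) - x ^ (i.1 + 1) * w (s j)| ≤ b) :
    |(Matrix.of fun (i j : Fin (k+1)) => w (i + s j)).det| ≤ (k + 1).factorial * (a * b ^ k) := by
  have e := Matrix.det_eq_of_forall_row_eq_smul_add_const
    (A := Matrix.of fun (i j : Fin (k+1)) => w (i + s j))
    (B := Matrix.of fun (i j : Fin (k+1)) => if i = 0 then w (s j) else w (i + s j) - x ^ i.1 * w (s j))
    (fun i => if i = 0 then 0 else x ^ i.1) 0 (by simp) (by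
      intro i j
      by_cases hi : i = 0
      · subst hi; simp
      · simp [hi])
  rw [e]
  apply det_bound
  · intro j; simpa using h0 j
  · intro i j
    have := h1 i j
    simpa [Fin.succ_ne_zero] using this

end Bern


namespace Bern
open Polynomial

lemma tc_mul_zero (x : ℝ) (F G : ℤ[X]) : tc x (F * G) 0 = tc x F 0 * tc x G 0 := by
  simp [tc_zero]

lemma tc_zero_coeff (F : ℤ[X]) (j : ℕ) : tc 0 F j = F.coeff j := by
  simp [tc]

lemma fact_low {x e c : ℝ} (he : e ≤ 1) (hc : 0 < c) (hc1 : c ≤ 1) (m : ℕ)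
    (hG : ∀ G : ℤ[X], Irreducible G → 0 < G.natDegree → G.natDegree < m + 1 →
      c * mm x 1 G ^ e ≤ |tc x G 0|) (R : ℤ[X]) :
    R ≠ 0 → R.natDegree ≤ m → c ^ R.natDegree * mm x 1 R ^ e ≤ |tc x R 0| := by
  have hconst : ∀ a : ℤ, a ≠ 0 → mm x 1 (C a) ^ e ≤ |tc x (C a) 0| := by
    intro a ha
    rw [mm_C, tc_zero]
    have h1 : (1:ℝ) ≤ |(a:ℝ)| := by exact_mod_cast Int.one_le_abs ha
    simpa using Real.rpow_le_rpow_of_exponent_le h1 he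
  induction R using UniqueFactorizationMonoid.induction_on_prime with
  | h₁ => intro h; exact absurd rfl h
  | h₂ u hu =>
    intro h hd
    obtain ⟨a, -, rfl⟩ := Polynomial.isUnit_iff.1 hu
    have := hconst a (by rintro rfl; simp at h)
    simpa using this
  | h₃ a p ha hp ih =>
    intro h hd
    have hp0 := hp.ne_zero
    rw [natDegree_mul hp0 ha] at hd ⊢
    have h1 := ih ha (by omega)
    have h2 : c ^ p.natDegree * mm x 1 p ^ e ≤ |tc x p 0| := by
      rcases Nat.eq_zero_or_pos p.natDegree with h0 | h0
      · rw [h0, pow_zero, one_mul]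
        obtain ⟨b, rfl⟩ := natDegree_eq_zero.1 h0
        exact hconst b (by rintro rfl; simp at hp0)
      · refine le_trans ?_ (hG p hp.irreducible h0 (by omega))
        have : c ^ p.natDegree ≤ c := pow_le_of_le_one hc.le hc1 h0.ne'
        exact mul_le_mul_of_nonneg_right this (Real.rpow_nonneg (mm_nonneg _ _ _) _)
    rw [mm_mul, tc_mul_zero, abs_mul, Real.mul_rpow (mm_nonneg _ _ _) (mm_nonneg _ _ _), pow_add]
    calc _ = (c ^ p.natDegree * mm x 1 p ^ e) * (c ^ a.natDegree * mm x 1 a ^ e) := by ring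
      _ ≤ _ := mul_le_mul h2 h1 (mul_nonneg (by positivity) (Real.rpow_nonneg (mm_nonneg _ _ _) _)) (abs_nonneg _)

lemma poly_of_vec {m : ℕ} (R : Fin (m + 1) → ℤ) (hR : R ≠ 0) (x K B : ℝ) (hx : |x| ≤ K)
    (hB : ∀ j, |(R j : ℝ)| ≤ B) :
    ∃ P : ℤ[X], P ≠ 0 ∧ P.natDegree ≤ m ∧ mm x 1 P ≤ (1 + K) ^ m * ((m + 1) * B) ∧
      tc x P 0 = ∑ j, (R j : ℝ) * x ^ j.1 := by
  have hK : 0 ≤ K := (abs_nonneg x).trans hx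
  set P : ℤ[X] := ∑ j : Fin (m + 1), C (R j) * X ^ j.1 with hP
  have hco : ∀ i : Fin (m + 1), P.coeff i = R i := by
    intro i
    simp only [hP, finset_sum_coeff, coeff_C_mul, coeff_X_pow]
    simp [← Fin.ext_iff]
  have hd : P.natDegree ≤ m := by
    apply natDegree_sum_le_of_forall_le
    intro j _
    exact (natDegree_C_mul_X_pow_le _ _).trans (by omega)
  refine ⟨P, ?_, hd, ?_, ?_⟩
  · rintro h0
    apply hR
    ext i
    rw [← hco, h0]; simp
  · refine (mm_compare x 0 K (by simpa using hx) P).trans ?_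
    have h1 := mm_le_sum 0 one_pos P m hd
    have h2 : mm 0 1 P ≤ (m + 1) * B := by
      refine h1.trans ?_
      rw [Finset.sum_range]
      refine (Finset.sum_le_sum (g := fun _ => B) fun j _ => ?_).trans ?_
      · rw [one_pow, mul_one, tc_zero_coeff, hco]; exact hB j
      · simp
    exact mul_le_mul (pow_le_pow_right₀ (by linarith) hd) h2 (mm_nonneg _ _ _) (by positivity)
  · rw [tc_zero]
    simp [hP, Polynomial.map_sum, eval_finset_sum]

end Bern


namespace Bern
open Polynomial

/-- the polynomial annihilating `q` -/
lemma poly_of_q {n h k : ℕ} (hh : 2 * h ≤ n) (hkh : k ≤ h) (hk : 2 * k < n) {lam x K : ℝ}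
    (hlam : 0 ≤ lam) (hK : 1 ≤ K) (hx : |x| ≤ K) :
    ∃ Cc : ℝ, 1 ≤ Cc ∧ ∀ q : Fin (n + 1) → ℤ, 1 ≤ q 0 → hankelRank n h q = h + 1 →
      (∀ i : Fin (n + 1), 1 ≤ i.1 →
        |(q 0 : ℝ) * x ^ (i.1) - (q i : ℝ)| ≤ (q 0 : ℝ) ^ (-lam)) →
      ∃ P : ℤ[X], P ≠ 0 ∧ P.natDegree ≤ n - k ∧
        mm x 1 P ≤ Cc * (q 0 : ℝ) ^ ((1 - k * lam) / ((n:ℝ) - 2 * k)) ∧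
        |tc x P 0| ≤ Cc * (q 0 : ℝ) ^ ((1 - k * lam) / ((n:ℝ) - 2 * k)) * (q 0 : ℝ) ^ (-(1 + lam)) := by
  have hKn : 1 ≤ K ^ n := one_le_pow₀ hK
  set C1 : ℝ := (k + 1).factorial * (2 * K ^ n) ^ (k + 1) with hC1
  have hC1' : 1 ≤ C1 := by
    have h1 : (1:ℝ) ≤ (k + 1).factorial := by exact_mod_cast Nat.one_le_iff_ne_zero.2 (Nat.factorial_ne_zero _)
    have h2 : (1:ℝ) ≤ (2 * K ^ n) ^ (k + 1) := one_le_pow₀ (by linarith)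
    exact one_le_mul_of_one_le_of_one_le h1 h2
  have hn1 : (1:ℝ) ≤ (n:ℝ) + 1 := by linarith [(Nat.cast_nonneg n : (0:ℝ) ≤ n)]
  have hn2 : (1:ℝ) ≤ (n:ℝ) + 2 := by linarith
  have hKK : (1:ℝ) ≤ (1 + K) ^ n := one_le_pow₀ (by linarith)
  refine ⟨(1 + K) ^ n * ((n + 1) * ((n + 2) * C1)), ?_, ?_⟩
  · exact one_le_mul_of_one_le_of_one_le hKK (one_le_mul_of_one_le_of_one_le hn1
      (one_le_mul_of_one_le_of_one_le hn2 hC1'))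
  intro q hq0 hrank hq
  set Q : ℝ := (q 0 : ℝ) with hQ
  have hQ1 : 1 ≤ Q := by rw [hQ]; exact_mod_cast hq0
  have hQ0 : 0 < Q := by linarith
  set ε : ℝ := Q ^ (-lam) with hε
  have hε0 : 0 < ε := Real.rpow_pos_of_pos hQ0 _
  have hε1 : ε ≤ 1 := Real.rpow_le_one_of_one_le_of_nonpos hQ1 (by linarith)
  set p : ℝ := (n:ℝ) - 2 * k with hp
  have hpn : p = ((n - 2 * k : ℕ) : ℝ) := by rw [Nat.cast_sub hk.le]; push_cast; rfl
  have hp1 : 1 ≤ p := by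
    rw [hpn]; exact_mod_cast (by omega : 1 ≤ n - 2 * k)
  set T' : ℝ := Q ^ ((1 - k * lam) / p) with hT'
  have hT'0 : 0 < T' := Real.rpow_pos_of_pos hQ0 _
  have hT'p : T' ^ (n - 2 * k) = Q * ε ^ k := by
    rw [hT', ← Real.rpow_natCast, ← Real.rpow_mul hQ0.le, ← hpn, div_mul_cancel₀ _ (by linarith), hε,
      ← Real.rpow_natCast, ← Real.rpow_mul hQ0.le,
      show (1 : ℝ) - k * lam = 1 + -lam * k by ring, Real.rpow_add hQ0, Real.rpow_one]
  set wz : ℕ → ℤ := fun i => q ⟨i % (n + 1), Nat.mod_lt _ n.succ_pos⟩ with hwz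
  set w : ℕ → ℝ := fun i => (wz i : ℝ) with hw
  have hwa : ∀ i, i ≤ n → |Q * x ^ i - w i| ≤ ε := by
    intro i hi
    rcases Nat.eq_zero_or_pos i with h0 | h0
    · subst h0
      simp only [hw, hwz, pow_zero, mul_one, Nat.zero_mod]
      have : Q - ((q ⟨0, n.succ_pos⟩ : ℤ):ℝ) = 0 := by rw [hQ, sub_eq_zero]; rfl
      rw [this, abs_zero]; exact hε0.le
    · have := hq ⟨i, by omega⟩ h0
      simp only [hw, hwz, Nat.mod_eq_of_lt (by omega : i < n + 1)]
      exact this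
  have hxp : ∀ i, i ≤ n → |x ^ i| ≤ K ^ n := by
    intro i hi
    rw [abs_pow]
    exact (pow_le_pow_left₀ (abs_nonneg _) hx i).trans (pow_le_pow_right₀ hK hi)
  have hw1 : ∀ i, i ≤ n → |w i| ≤ 2 * K ^ n * Q := by
    intro i hi
    have h1 := hwa i hi
    have h2 : |Q * x ^ i| ≤ Q * K ^ n := by
      rw [abs_mul, abs_of_pos hQ0]; exact mul_le_mul_of_nonneg_left (hxp i hi) hQ0.le
    have h3 : |w i| ≤ |Q * x ^ i| + |Q * x ^ i - w i| := by
      have := abs_sub (Q * x ^ i) (Q * x ^ i - w i)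
      simpa using this
    nlinarith
  have hw2 : ∀ i j, i + j ≤ n → |w (i + j) - x ^ i * w j| ≤ 2 * K ^ n * ε := by
    intro i j hij
    have h1 := hwa (i + j) hij
    have h2 := hwa j (by omega)
    have e : w (i + j) - x ^ i * w j = x ^ i * (Q * x ^ j - w j) - (Q * x ^ (i + j) - w (i + j)) := by
      rw [pow_add]; ring
    rw [e]
    refine (abs_sub _ _).trans ?_
    rw [abs_mul]
    have := mul_le_mul (hxp i (by omega)) h2 (abs_nonneg _) (by positivity)
    nlinarith
  set M : Matrix (Fin (k + 1)) (Fin (n - k + 1)) ℤ := Matrix.of fun i j => wz (i.1 + j.1) with hM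
  obtain ⟨S0, hS0⟩ := exists_minor _ (hankel_li hh hkh q hrank)
  obtain ⟨S, hS⟩ := Finite.exists_max (fun S : Fin (k + 1) → Fin (n - k + 1) => |(M.submatrix id S).det|)
  have hD : (M.submatrix id S).det ≠ 0 := by
    intro h0
    have h1 := hS S0
    simp only [h0, abs_zero] at h1
    have h2 := abs_nonpos_iff.1 h1
    apply hS0
    have h3 := congrArg (Int.cast : ℤ → ℚ) h2
    rw [Int.cast_det, Int.cast_zero] at h3
    exact h3
  have hDb : |((M.submatrix id S).det : ℝ)| ≤ C1 * T' ^ (n - 2 * k) := by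
    have h1 := hankel_det x (2 * K ^ n * Q) (2 * K ^ n * ε) w (fun j => (S j).1)
      (fun j => hw1 _ (by have := (S j).2; omega)) (fun i j => hw2 _ _ (by have := (S j).2; have := i.2; omega))
    have h2 : ((M.submatrix id S).det : ℝ) = (Matrix.of fun (i j : Fin (k+1)) => w (i + (S j).1)).det := by
      rw [Int.cast_det]; rfl
    rw [h2]
    refine h1.trans (le_of_eq ?_)
    rw [hT'p, hC1]; ring
  set T : ℕ := ⌊C1 * T'⌋₊ with hT
  have hTf : (T:ℝ) ≤ C1 * T' := Nat.floor_le (by positivity)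
  have hTl : C1 * T' < T + 1 := Nat.lt_floor_add_one _
  have hpne : n - 2 * k ≠ 0 := by omega
  obtain ⟨R, hR0, hMR, hRb⟩ := siegel M S hD hS T (by
    rw [Fintype.card_fin, Fintype.card_fin, show n - k + 1 - (k + 1) = n - 2 * k by omega]
    have h1 : (((M.submatrix id S).det.natAbs : ℕ) : ℝ) < ((T + 1) ^ (n - 2 * k) : ℕ) := by
      rw [Nat.cast_natAbs, Int.cast_abs]
      refine hDb.trans_lt ?_
      push_cast
      refine lt_of_le_of_lt ?_ (pow_lt_pow_left₀ hTl (by positivity) hpne)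
      rw [mul_pow]
      exact mul_le_mul_of_nonneg_right (le_self_pow₀ hC1' hpne) (by positivity)
    exact_mod_cast h1)
  have hRb' : ∀ j, |(R j : ℝ)| ≤ (n + 2) * (C1 * T') := by
    intro j
    have h1 := hRb j
    rw [Fintype.card_fin] at h1
    have h2 : |(R j : ℝ)| ≤ ((n - k + 1 : ℕ) : ℝ) * T + T := by exact_mod_cast h1
    have h3 : ((n - k + 1 : ℕ) : ℝ) ≤ n + 1 := by exact_mod_cast (by omega : n - k + 1 ≤ n + 1)
    have h4 : (0:ℝ) ≤ T := Nat.cast_nonneg _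
    nlinarith
  have hmn : ((n - k : ℕ) : ℝ) + 1 ≤ n + 1 := by exact_mod_cast (by omega : n - k + 1 ≤ n + 1)
  obtain ⟨P, hP0, hPd, hPm, hPt⟩ := poly_of_vec R hR0 x K _ hx hRb'
  refine ⟨P, hP0, hPd, ?_, ?_⟩
  · refine hPm.trans ?_
    calc _ ≤ (1 + K) ^ n * ((n + 1) * ((n + 2) * (C1 * T'))) := by
          gcongr
          · linarith
          · omega
      _ = _ := by ring
  · have h1 : ∑ j, (R j : ℝ) * w j.1 = 0 := by
      have h2 := congrFun hMR 0
      have h3 : ∑ j : Fin (n - k + 1), wz (0 + j.1) * R j = 0 := h2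
      have h4 := congrArg (Int.cast : ℤ → ℝ) h3
      push_cast at h4
      rw [← h4]
      refine Finset.sum_congr rfl fun j _ => ?_
      rw [zero_add, mul_comm]
    have h2 : Q * tc x P 0 = ∑ j, (R j : ℝ) * (Q * x ^ j.1 - w j.1) := by
      simp only [mul_sub, Finset.sum_sub_distrib, h1, sub_zero]
      rw [hPt, Finset.mul_sum]
      exact Finset.sum_congr rfl fun j _ => by ring
    have h3 : Q * |tc x P 0| ≤ (n + 1) * ((n + 2) * (C1 * T') * ε) := by
      rw [← abs_of_pos hQ0, ← abs_mul, h2]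
      refine (Finset.abs_sum_le_sum_abs _ _).trans ?_
      refine (Finset.sum_le_sum (g := fun _ => (n + 2) * (C1 * T') * ε) fun j _ => ?_).trans ?_
      · rw [abs_mul]
        exact mul_le_mul (hRb' j) (hwa j (by omega)) (abs_nonneg _) (by positivity)
      · rw [Finset.sum_const, Finset.card_univ, Fintype.card_fin, nsmul_eq_mul]
        push_cast
        exact mul_le_mul_of_nonneg_right hmn (by positivity)
    have h4 : Q ^ (-(1 + lam)) = ε / Q := by
      rw [hε, neg_add, Real.rpow_add hQ0, Real.rpow_neg_one]; field_simp
    rw [h4, mul_div_assoc', le_div_iff₀ hQ0, mul_comm]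
    refine h3.trans ?_
    calc _ ≤ (1 + K) ^ n * ((n + 1) * ((n + 2) * (C1 * T') * ε)) :=
          le_mul_of_one_le_left (by positivity) hKK
      _ = _ := by ring

end Bern


namespace Bern
open Polynomial

lemma finite_q (n : ℕ) (x B : ℝ) : {q : Fin (n + 1) → ℤ | 1 ≤ q 0 ∧ (q 0 : ℝ) ≤ B ∧
    ∀ i : Fin (n + 1), 1 ≤ i.1 → |(q 0 : ℝ) * x ^ (i.1) - (q i : ℝ)| ≤ 1}.Finite := by
  set N : ℤ := ⌈B * (1 + |x|) ^ n + 1⌉ with hN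
  refine Set.Finite.subset (Set.Finite.pi (ι := Fin (n + 1)) (t := fun _ => Set.Icc (-N) N)
    fun _ => Set.finite_Icc _ _) ?_
  rintro q ⟨h1, h2, h3⟩ i -
  have hQ : (1:ℝ) ≤ q 0 := by exact_mod_cast h1
  have key : |(q i : ℝ)| ≤ B * (1 + |x|) ^ n + 1 := by
    have hp : (1:ℝ) ≤ (1 + |x|) ^ n := one_le_pow₀ (by linarith [abs_nonneg x])
    by_cases hi : 1 ≤ i.1
    · have h4 := h3 i hi
      have h5 : |(q 0 : ℝ) * x ^ i.1| ≤ B * (1 + |x|) ^ n := by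
        rw [abs_mul, abs_of_pos (by linarith), abs_pow]
        refine mul_le_mul h2 ?_ (by positivity) (by linarith)
        exact (pow_le_pow_left₀ (abs_nonneg _) (by linarith) _).trans
          (pow_le_pow_right₀ (by linarith [abs_nonneg x]) (by omega))
      have h6 := abs_sub ((q 0 : ℝ) * x ^ i.1) ((q 0 : ℝ) * x ^ i.1 - q i)
      rw [sub_sub_cancel] at h6
      linarith
    · have : i = 0 := Fin.ext (by rw [Fin.val_zero]; omega)
      subst this
      rw [abs_of_pos (by linarith)]
      nlinarith
  have h7 : |(q i : ℝ)| ≤ (N:ℝ) := key.trans (Int.le_ceil _)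
  have h8 : |q i| ≤ N := by exact_mod_cast h7
  exact abs_le.1 h8

lemma mem_BS {n h k : ℕ} (hh : 2 * h ≤ n) (hkh : k ≤ h) (hk : 2 * k < n) {lam x K s : ℝ}
    (hlam : 0 ≤ lam) (hK : 1 ≤ K) (hx : |x| ≤ K) (hkl : 0 < 1 - k * lam) (hs0 : 0 < s)
    (hs : ((n:ℝ) - k + 1) * (1 - k * lam) / (((n:ℝ) - 2 * k) * (1 + lam)) < s) (hs1 : s ≤ 1)
    (htr : ∀ F : ℤ[X], F ≠ 0 → tc x F 0 ≠ 0)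
    (hinf : {q : Fin (n + 1) → ℤ | 1 ≤ q 0 ∧ IsTypeVec n h q ∧
      ∀ i : Fin (n + 1), 1 ≤ i.1 →
      |(q 0 : ℝ) * x ^ (i.1) - (q i : ℝ)| ≤ (q 0 : ℝ) ^ (-lam)}.Infinite) :
    ∃ d ∈ Finset.Icc 1 (n - k), x ∈ BS K s d := by
  by_contra hcon
  push Not at hcon
  have hp0 : (0:ℝ) < (n:ℝ) - 2 * k := by
    have : (2:ℝ) * k < n := by exact_mod_cast hk
    linarith
  have hmc : ((n - k : ℕ) : ℝ) = (n:ℝ) - k := by rw [Nat.cast_sub (by omega)]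
  set v : ℝ := ((n:ℝ) - k + 1) / s with hv
  have hnum : (0:ℝ) < (n:ℝ) - k + 1 := by
    rw [← hmc]; positivity
  have hv0 : 0 < v := div_pos hnum hs0
  have hv1 : 1 ≤ v := by
    rw [hv, le_div_iff₀ hs0, ← hmc]
    have : (0:ℝ) ≤ ((n - k : ℕ) : ℝ) := Nat.cast_nonneg _
    linarith
  set α : ℝ := (1 - k * lam) / ((n:ℝ) - 2 * k) with hα
  have hα0 : 0 < α := div_pos hkl hp0
  have hvα : v * α < 1 + lam := by
    rw [div_lt_iff₀ (by positivity)] at hs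
    rw [hv, hα, div_mul_div_comm, div_lt_iff₀ (by positivity)]
    linarith
  -- finiteness
  have hfin : ∀ f, 0 < f → f < n - k + 1 → (apx x f (1 - v)).Finite := by
    intro f hf hf'
    have h1 := hcon f (Finset.mem_Icc.2 ⟨hf, by omega⟩)
    have h2 : (apx x f (1 - ((f:ℝ) + 1) / s)).Finite := by
      by_contra h3
      exact h1 ⟨hx, h3⟩
    refine h2.subset ?_
    rintro F ⟨hF, hF2⟩
    refine ⟨hF, hF2.trans ?_⟩
    apply Real.rpow_le_rpow_of_exponent_le (one_le_mm x hF.1.ne_zero)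
    have : ((f:ℝ) + 1) / s ≤ v := by
      rw [hv]
      have : (f:ℝ) ≤ (n:ℝ) - k := by rw [← hmc]; exact_mod_cast (by omega : f ≤ n - k)
      gcongr
    linarith
  obtain ⟨c, hc0, hc1, hlow⟩ := low_const htr (n - k + 1) (fun _ => 1 - v) hfin
  obtain ⟨Cc, hC1, hpoly⟩ := poly_of_q hh hkh hk hlam hK hx
  have hC0 : 0 < Cc := by linarith
  set δ : ℝ := 1 + lam - v * α with hδ
  have hδ0 : 0 < δ := by linarith
  set B : ℝ := (Cc ^ v / c ^ (n - k)) ^ (1 / δ) with hB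
  apply hinf
  refine (finite_q n x B).subset ?_
  rintro q ⟨hq0, hqt, hqa⟩
  set Q : ℝ := (q 0 : ℝ) with hQ
  have hQ1 : 1 ≤ Q := by rw [hQ]; exact_mod_cast hq0
  have hQ0 : 0 < Q := by linarith
  refine ⟨hq0, ?_, fun i hi => (hqa i hi).trans (Real.rpow_le_one_of_one_le_of_nonpos hQ1 (by linarith))⟩
  obtain ⟨P, hP0, hPd, hPm, hPt⟩ := hpoly q hq0 hqt.2.1 hqa
  have h1 := fact_low (by linarith : 1 - v ≤ 1) hc0 hc1 (n - k) hlow P hP0 hPd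
  have h2 : c ^ (n - k) * (Cc * Q ^ α) ^ (1 - v) ≤ Cc * Q ^ α * Q ^ (-(1 + lam)) := by
    refine le_trans ?_ (h1.trans hPt)
    refine mul_le_mul (pow_le_pow_of_le_one hc0.le hc1 hPd) ?_ (by positivity) (by positivity)
    exact Real.rpow_le_rpow_of_nonpos (by linarith [one_le_mm x hP0]) hPm (by linarith)
  have hQα : 0 < Q ^ α := Real.rpow_pos_of_pos hQ0 _
  have h3 : Q ^ δ ≤ Cc ^ v / c ^ (n - k) := by
    rw [le_div_iff₀ (by positivity)]
    have hX : 0 < Cc * Q ^ α := by positivity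
    have e1 : (Cc * Q ^ α) ^ (1 - v) = (Cc * Q ^ α) * ((Cc * Q ^ α) ^ v)⁻¹ := by
      rw [Real.rpow_sub hX, Real.rpow_one, div_eq_mul_inv]
    have e2 : (Cc * Q ^ α) ^ v = Cc ^ v * Q ^ (v * α) := by
      rw [Real.mul_rpow hC0.le hQα.le, ← Real.rpow_mul hQ0.le, mul_comm α v]
    have e3 : Q ^ δ = Q ^ (1 + lam) * (Q ^ (v * α))⁻¹ := by
      rw [hδ, Real.rpow_sub hQ0, div_eq_mul_inv]
    rw [e1, e2, Real.rpow_neg hQ0.le] at h2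
    rw [e3]
    have hV : 0 < Cc ^ v := Real.rpow_pos_of_pos hC0 _
    have hW : 0 < Q ^ (v * α) := Real.rpow_pos_of_pos hQ0 _
    have hZ : 0 < Q ^ (1 + lam) := Real.rpow_pos_of_pos hQ0 _
    generalize Cc ^ v = V at *
    generalize Q ^ (v * α) = W at *
    generalize Q ^ (1 + lam) = Z at *
    have h4 : c ^ (n - k) * (V * W)⁻¹ ≤ Z⁻¹ := by
      refine le_of_mul_le_mul_left ?_ hX
      calc _ = _ := by ring
        _ ≤ _ := h2
    calc Z * W⁻¹ * c ^ (n - k) = (c ^ (n - k) * (V * W)⁻¹) * (Z * V) := by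
          field_simp
      _ ≤ Z⁻¹ * (Z * V) := mul_le_mul_of_nonneg_right h4 (by positivity)
      _ = V := by field_simp
  calc Q = (Q ^ δ) ^ (1 / δ) := by
        rw [← Real.rpow_mul hQ0.le, mul_one_div_cancel hδ0.ne', Real.rpow_one]
    _ ≤ B := Real.rpow_le_rpow (by positivity) h3 (by positivity)

end Bern

/-- For `n ≥ 2`, `0 ≤ h ≤ n/2`, a compact interval `I` not containing `0`,
`1/n ≤ λ ≤ 2/n` and any integer `0 ≤ k ≤ min{h, (n−1)/2}`,
`dim S_n^h(I, λ) ≤ (n−k+1)(1−kλ) / ((n−2k)(1+λ))`. -/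
theorem stmt7 (n h k : ℕ) (hn : 2 ≤ n) (hh : 2 * h ≤ n)
    (A B : ℝ) (hAB : A ≤ B) (h0 : (0 : ℝ) ∉ Set.Icc A B)
    (lam : ℝ) (h1 : 1 / (n : ℝ) ≤ lam) (h2 : lam ≤ 2 / (n : ℝ))
    (hk1 : k ≤ h) (hk2 : (k : ℝ) ≤ ((n : ℝ) - 1) / 2) :
    dimH (TypeSimSet n h (Set.Icc A B) lam) ≤
      ENNReal.ofReal
        (((n : ℝ) - k + 1) * (1 - k * lam) / (((n : ℝ) - 2 * k) * (1 + lam))) := by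
  have hk : 2 * k < n := by
    have : (2 * k + 1 : ℝ) ≤ n := by linarith
    exact_mod_cast this
  have hn0 : (0:ℝ) < n := by positivity
  have hlam : 0 ≤ lam := le_trans (by positivity) h1
  have hp0 : (0:ℝ) < (n:ℝ) - 2 * k := by
    have : (2:ℝ) * k < n := by exact_mod_cast hk
    linarith
  have hln : lam * n ≤ 2 := by rwa [le_div_iff₀ hn0] at h2
  have hk0 : (0:ℝ) ≤ k := Nat.cast_nonneg _
  have hkl : 0 < 1 - k * lam := by
    have : (k * lam) * n ≤ 2 * k := by nlinarith
    by_contra h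
    push Not at h
    nlinarith
  have hkl2 : (n:ℝ) - 2 * k ≤ (1 - k * lam) * n := by nlinarith
  set s0 : ℝ := ((n : ℝ) - k + 1) * (1 - k * lam) / (((n : ℝ) - 2 * k) * (1 + lam)) with hs0
  have hhalf : 1 / 2 ≤ s0 := by
    rw [hs0, div_le_div_iff₀ (by norm_num) (by positivity), one_mul]
    have e1 : ((n : ℝ) - 2 * k) * (1 + lam) ≤ (1 - k * lam) * (n + 2) := by
      nlinarith
    nlinarith
  have hle1 : dimH (TypeSimSet n h (Set.Icc A B) lam) ≤ 1 :=
    (dimH_mono (Set.subset_univ _)).trans Real.dimH_univ.le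
  apply le_of_forall_gt_imp_ge_of_dense
  intro a ha
  by_cases ha1 : 1 ≤ a
  · exact hle1.trans ha1
  push Not at ha1
  have hat : a ≠ ⊤ := (ha1.trans ENNReal.one_lt_top).ne
  set s := a.toReal with hs
  have hsa : a = ENNReal.ofReal s := (ENNReal.ofReal_toReal hat).symm
  have hs0s : s0 < s := (ENNReal.ofReal_lt_iff_lt_toReal (by linarith) hat).1 ha
  have hs1 : s ≤ 1 := by
    have := ENNReal.toReal_mono ENNReal.one_ne_top ha1.le
    simpa using this
  rw [hsa]
  set K : ℝ := |A| + |B| + 1 with hK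
  have hK1 : 1 ≤ K := by have := abs_nonneg A; have := abs_nonneg B; linarith
  have hsub : TypeSimSet n h (Set.Icc A B) lam ⊆ {x : ℝ | ∃ F : Polynomial ℤ, F ≠ 0 ∧ Bern.tc x F 0 = 0} ∪
      ⋃ d ∈ (Finset.Icc 1 (n - k) : Set ℕ), Bern.BS K s d := by
    rintro x ⟨hxI, hinf⟩
    by_cases htr : ∃ F : Polynomial ℤ, F ≠ 0 ∧ Bern.tc x F 0 = 0
    · exact Or.inl htr
    · right
      push Not at htr
      have hx : |x| ≤ K := by
        rw [abs_le]
        have a1 := neg_abs_le A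
        have a2 := le_abs_self B
        have a3 := abs_nonneg A
        have a4 := abs_nonneg B
        constructor <;> linarith [hxI.1, hxI.2]
      obtain ⟨d, hd, hxd⟩ := Bern.mem_BS hh hk1 hk hlam hK1 hx hkl (by linarith) hs0s hs1 htr hinf
      simp only [Set.mem_iUnion]
      exact ⟨d, hd, hxd⟩
  refine (dimH_mono hsub).trans ?_
  rw [dimH_union]
  refine max_le ?_ ?_
  · rw [dimH_countable Bern.alg_countable]; exact zero_le
  · refine (dimH_bUnion (Finset.countable_toSet _) _).le.trans ?_
    refine iSup₂_le fun d hd => ?_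
    exact Bern.dimBS (by linarith) hs1 (by linarith) d (Finset.mem_Icc.1 hd).1
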